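/- arXiv:1311.1994 — 2 statements merged into one kernel-verified Lean document; each statement's English description precedes it below -/
import Mathlib

section
/- Let G be a finite simple graph that is 1-planar, and let D be a 1-planar drawing of G whose number of crossings is minimum among all 1-planar drawings of G. Then for any two distinct crossings c₁ and c₂ of D, the cluster sets satisfy |S(c₁) ∩ S(c₂)| ≤ 2. -/
open Set

/-- Two subsets of the plane *properly cross* at a point `p`: in some open
neighbourhood of `p` the pair of sets looks, up to homeomorphism, like the two
coordinate axes meeting at the origin. -/
def ProperCross (A₁ A₂ : Set (ℝ × ℝ)) (p : ℝ × ℝ) : Prop :=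
  ∃ U : Set (ℝ × ℝ), IsOpen U ∧ ∃ hp : p ∈ U, ∃ φ : U ≃ₜ (ℝ × ℝ),
    φ ⟨p, hp⟩ = (0, 0) ∧
    (fun x => φ x) '' {x : U | (x : ℝ × ℝ) ∈ A₁} = {q : ℝ × ℝ | q.2 = 0} ∧
    (fun x => φ x) '' {x : U | (x : ℝ × ℝ) ∈ A₂} = {q : ℝ × ℝ | q.1 = 0}

/-- A drawing of a simple graph `G` in the plane: vertices go to distinct points,
each edge is drawn as a continuous injective arc joining the points of its two
endpoints, no arc passes through the point of a vertex other than its endpoints,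
arcs of edges sharing an endpoint meet only at that common point, any two arcs
meet in finitely many points, every intersection point of two arcs that is not a
common endpoint is a proper crossing, and no point of the plane that is not a
vertex point lies on more than two arcs. -/
structure Drawing {V : Type*} (G : SimpleGraph V) where
  pos : V → ℝ × ℝ
  pos_inj : Function.Injective pos
  arc : G.edgeSet → ℝ → ℝ × ℝ
  arc_cont : ∀ e, ContinuousOn (arc e) (Icc 0 1)
  arc_inj : ∀ e, InjOn (arc e) (Icc 0 1)
  arc_ends : ∀ e : G.edgeSet, ∃ u v : V, (e : Sym2 V) = s(u, v) ∧
    arc e 0 = pos u ∧ arc e 1 = pos v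
  no_vertex_interior : ∀ (e : G.edgeSet) (v : V), v ∉ (e : Sym2 V) →
    pos v ∉ arc e '' Icc 0 1
  shared_endpoint : ∀ e₁ e₂ : G.edgeSet, e₁ ≠ e₂ → ∀ v : V,
    v ∈ (e₁ : Sym2 V) → v ∈ (e₂ : Sym2 V) →
    arc e₁ '' Icc 0 1 ∩ arc e₂ '' Icc 0 1 ⊆ {pos v}
  finite_meet : ∀ e₁ e₂ : G.edgeSet, e₁ ≠ e₂ →
    (arc e₁ '' Icc 0 1 ∩ arc e₂ '' Icc 0 1).Finite
  proper : ∀ e₁ e₂ : G.edgeSet, e₁ ≠ e₂ →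
    ∀ p ∈ arc e₁ '' Icc 0 1 ∩ arc e₂ '' Icc 0 1, p ∉ Set.range pos →
    ProperCross (arc e₁ '' Icc 0 1) (arc e₂ '' Icc 0 1) p
  at_most_two : ∀ p : ℝ × ℝ, p ∉ Set.range pos →
    ∀ e₁ e₂ e₃ : G.edgeSet, p ∈ arc e₁ '' Icc 0 1 → p ∈ arc e₂ '' Icc 0 1 →
      p ∈ arc e₃ '' Icc 0 1 → e₁ = e₂ ∨ e₁ = e₃ ∨ e₂ = e₃

namespace Drawing

variable {V : Type*} {G : SimpleGraph V}

/-- The image of the arc drawn for the edge `e`. -/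
def arcIm (D : Drawing G) (e : G.edgeSet) : Set (ℝ × ℝ) :=
  D.arc e '' Icc 0 1

/-- The set of crossings of the drawing: points that are not vertex points and
lie on (at least, hence exactly) two arcs.  (An intersection point of two arcs
that is a common endpoint of the two edges is a vertex point, and conversely a
vertex point on two arcs is a common endpoint, so these are precisely the
intersection points of pairs of arcs that are not common endpoints.) -/
def crossings (D : Drawing G) : Set (ℝ × ℝ) :=
  {p | p ∉ Set.range D.pos ∧ ∃ e₁ e₂ : G.edgeSet, e₁ ≠ e₂ ∧ p ∈ D.arcIm e₁ ∧ p ∈ D.arcIm e₂}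

/-- The number of crossings of the drawing. -/
noncomputable def crossingCount (D : Drawing G) : ℕ := D.crossings.ncard

/-- The cluster set `S(c)` of a crossing `c`: the set of end-vertices of the
(two) edges whose arcs pass through `c`. -/
def cluster (D : Drawing G) (c : ℝ × ℝ) : Set V :=
  {v | ∃ e : G.edgeSet, c ∈ D.arcIm e ∧ v ∈ (e : Sym2 V)}

/-- A drawing is 1-planar if each edge's arc is crossed at most once. -/
def IsOnePlanar (D : Drawing G) : Prop :=
  ∀ e : G.edgeSet, {p | p ∈ D.crossings ∧ p ∈ D.arcIm e}.Subsingleton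

/-- A drawing is NIC-planar if it is 1-planar and the cluster sets of any two
distinct crossings share at most one vertex. -/
def IsNICPlanar (D : Drawing G) : Prop :=
  D.IsOnePlanar ∧ ∀ c₁ ∈ D.crossings, ∀ c₂ ∈ D.crossings, c₁ ≠ c₂ →
    (D.cluster c₁ ∩ D.cluster c₂).ncard ≤ 1

/-- A drawing is IC-planar if it is 1-planar and the cluster sets of any two
distinct crossings are disjoint. -/
def IsICPlanar (D : Drawing G) : Prop :=
  D.IsOnePlanar ∧ ∀ c₁ ∈ D.crossings, ∀ c₂ ∈ D.crossings, c₁ ≠ c₂ →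
    D.cluster c₁ ∩ D.cluster c₂ = ∅

end Drawing

/-- A graph is 1-planar if it admits a 1-planar drawing. -/
def SimpleGraph.OnePlanar {V : Type*} (G : SimpleGraph V) : Prop :=
  ∃ D : Drawing G, D.IsOnePlanar

/-- A graph is NIC-planar if it admits an NIC-planar drawing. -/
def SimpleGraph.NICPlanar {V : Type*} (G : SimpleGraph V) : Prop :=
  ∃ D : Drawing G, D.IsNICPlanar

/-- A graph is IC-planar if it admits an IC-planar drawing. -/
def SimpleGraph.ICPlanar {V : Type*} (G : SimpleGraph V) : Prop :=
  ∃ D : Drawing G, D.IsICPlanar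

/-- The crossing number of `G`: the minimum number of crossings over all
drawings of `G`. -/
noncomputable def SimpleGraph.crossingNumber {V : Type*} (G : SimpleGraph V) : ℕ :=
  sInf {n | ∃ D : Drawing G, D.crossingCount = n}
/-- The graph `H` is a minimum non-NIC-planar graph: `H` is not NIC-planar but
deleting any single edge of `H` yields an NIC-planar graph. -/
def MinNonNICPlanar {V : Type*} (H : SimpleGraph V) : Prop :=
  ¬ H.NICPlanar ∧ ∀ e ∈ H.edgeSet, (H.deleteEdges {e}).NICPlanar

/-- The graph `H` is a minimum non-IC-planar graph: `H` is not IC-planar but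
deleting any single edge of `H` yields an IC-planar graph. -/
def MinNonICPlanar {V : Type*} (H : SimpleGraph V) : Prop :=
  ¬ H.ICPlanar ∧ ∀ e ∈ H.edgeSet, (H.deleteEdges {e}).ICPlanar

/-- The complete multipartite graph with parts of sizes `a 0, …, a (k-1)`. -/
abbrev completeMultipartite {k : ℕ} (a : Fin k → ℕ) :
    SimpleGraph (Σ i : Fin k, Fin (a i)) :=
  SimpleGraph.completeMultipartiteGraph fun i => Fin (a i)

/-- `G` contains a subgraph isomorphic to `H`, i.e. there is an injective graph
homomorphism from `H` to `G`. -/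
def ContainsSubgraphIso {V W : Type*} (G : SimpleGraph V) (H : SimpleGraph W) : Prop :=
  ∃ f : H →g G, Function.Injective f

/-- The set `A` is an arc from `a` to `b`. -/
def IsArc (A : Set (ℝ × ℝ)) (a b : ℝ × ℝ) : Prop :=
  ∃ f : ℝ → ℝ × ℝ, ContinuousOn f (Icc 0 1) ∧ InjOn f (Icc 0 1) ∧ f 0 = a ∧ f 1 = b ∧
    f '' Icc 0 1 = A

theorem isArc_image_Icc {f : ℝ → ℝ × ℝ} {s t : ℝ} (hst : s < t) (hf : ContinuousOn f (Icc s t))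
    (hi : InjOn f (Icc s t)) : IsArc (f '' Icc s t) (f s) (f t) := by
  have himg : (fun u : ℝ => s + u * (t - s)) '' Icc 0 1 = Icc s t := by
    ext v
    constructor
    · rintro ⟨u, ⟨hu0, hu1⟩, rfl⟩
      constructor <;> simp only <;> nlinarith
    · rintro ⟨hv0, hv1⟩
      refine ⟨(v - s) / (t - s), ⟨by apply div_nonneg <;> linarith, ?_⟩, ?_⟩
      · rw [div_le_one] <;> linarith
      · have : t - s ≠ 0 := by linarith
        field_simp
        ring
  have hmaps : MapsTo (fun u : ℝ => s + u * (t - s)) (Icc 0 1) (Icc s t) := by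
    rw [← himg]; exact mapsTo_image _ _
  refine ⟨fun u => f (s + u * (t - s)), hf.comp (by fun_prop) hmaps, ?_, by simp, by simp, ?_⟩
  · intro u hu v hv huv
    have h := hi (hmaps hu) (hmaps hv) huv
    have h1 : u * (t - s) = v * (t - s) := by simpa using h
    exact mul_right_cancel₀ (by linarith) h1
  · rw [← himg, image_image]

theorem IsArc.symm {A : Set (ℝ × ℝ)} {a b : ℝ × ℝ} (h : IsArc A a b) : IsArc A b a := by
  obtain ⟨f, hf, hi, h0, h1, hA⟩ := h
  have himg : (fun u : ℝ => 1 - u) '' Icc 0 1 = Icc 0 1 := by simp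
  have hmaps : MapsTo (fun u : ℝ => 1 - u) (Icc 0 1) (Icc 0 1) := by
    intro u hu
    simp only [mem_Icc] at hu ⊢
    constructor <;> linarith
  refine ⟨fun u => f (1 - u), hf.comp (by fun_prop) hmaps, ?_, by simpa, by simpa, ?_⟩
  · intro u hu v hv huv
    have h := hi (hmaps hu) (hmaps hv) huv
    linarith
  · rw [← hA]
    nth_rewrite 2 [← himg]
    rw [image_image]

theorem IsArc.union {A B : Set (ℝ × ℝ)} {a b c : ℝ × ℝ} (hA : IsArc A a b) (hB : IsArc B b c)
    (hAB : A ∩ B ⊆ {b}) : IsArc (A ∪ B) a c := by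
  obtain ⟨f, hf, hfi, hf0, hf1, rfl⟩ := hA
  obtain ⟨g, hg, hgi, hg0, hg1, rfl⟩ := hB
  have key : IsArc ((fun t => if t ≤ 1 then f t else g (t - 1)) '' Icc 0 2)
      ((fun t => if t ≤ 1 then f t else g (t - 1)) 0)
      ((fun t => if t ≤ 1 then f t else g (t - 1)) 2) := by
    apply isArc_image_Icc (by norm_num)
    · have h1 : Icc (0 : ℝ) 2 = Icc 0 1 ∪ Icc 1 2 := by
        rw [Icc_union_Icc_eq_Icc] <;> norm_num
      rw [h1]
      apply ContinuousOn.union_of_isClosed _ _ isClosed_Icc isClosed_Icc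
      · apply hf.congr
        intro t ht
        simp [ht.2]
      · have : ContinuousOn (fun t : ℝ => g (t - 1)) (Icc 1 2) := by
          apply hg.comp (by fun_prop)
          intro t ht
          simp only [mem_Icc] at ht ⊢
          constructor <;> linarith
        apply this.congr
        intro t ht
        simp only
        split_ifs with h
        · have : t = 1 := le_antisymm h ht.1
          subst this
          simp [hf1, hg0]
        · rfl
    · have cross : ∀ t ∈ Icc (0 : ℝ) 2, ∀ u ∈ Icc (0 : ℝ) 2, t ≤ 1 → ¬ u ≤ 1 →
          f t ≠ g (u - 1) := by
        intro t ht u hu ht1 hu1 h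
        have hu' : u - 1 ∈ Icc (0 : ℝ) 1 := ⟨by linarith, by linarith [hu.2]⟩
        have hb : g (u - 1) = b := hAB ⟨⟨t, ⟨ht.1, ht1⟩, h⟩, ⟨_, hu', rfl⟩⟩
        have := hgi hu' (by simp) (hb.trans hg0.symm)
        exact hu1 (by linarith)
      intro t ht u hu h
      simp only at h
      split_ifs at h with h1 h2 h2
      · exact hfi ⟨ht.1, h1⟩ ⟨hu.1, h2⟩ h
      · exact absurd h (cross t ht u hu h1 h2)
      · exact absurd h.symm (cross u hu t ht h2 h1)
      · have := hgi (x₁ := t - 1) (x₂ := u - 1) ⟨by linarith, by linarith [ht.2]⟩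
          ⟨by linarith, by linarith [hu.2]⟩ h
        linarith
  have himg : (fun t => if t ≤ 1 then f t else g (t - 1)) '' Icc 0 2 =
      f '' Icc 0 1 ∪ g '' Icc 0 1 := by
    ext p
    constructor
    · rintro ⟨t, ht, rfl⟩
      simp only
      split_ifs with h
      · exact Or.inl ⟨t, ⟨ht.1, h⟩, rfl⟩
      · exact Or.inr ⟨t - 1, ⟨by linarith, by linarith [ht.2]⟩, rfl⟩
    · rintro (⟨t, ht, rfl⟩ | ⟨t, ht, rfl⟩)
      · exact ⟨t, ⟨ht.1, by linarith [ht.2]⟩, by simp [ht.2]⟩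
      · refine ⟨t + 1, ⟨by linarith [ht.1], by linarith [ht.2]⟩, ?_⟩
        simp only
        split_ifs with h
        · have : t = 0 := le_antisymm (by linarith) ht.1
          subst this
          simp [hf1, hg0]
        · simp
  rw [himg] at key
  convert key using 1
  · simp [hf0]
  · norm_num [hg1]

theorem isArc_segment {a b : ℝ × ℝ} (h : a ≠ b) : IsArc (segment ℝ a b) a b := by
  refine ⟨AffineMap.lineMap a b, by
    exact (AffineMap.lineMap_continuous (R := ℝ)).continuousOn,
    (AffineMap.lineMap_injective ℝ h).injOn, by simp, by simp, ?_⟩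
  rw [segment_eq_image_lineMap]

theorem IsArc.image {A : Set (ℝ × ℝ)} {a b : ℝ × ℝ} (h : IsArc A a b)
    {g : ℝ × ℝ → ℝ × ℝ} (hg : Continuous g) (hi : Function.Injective g) :
    IsArc (g '' A) (g a) (g b) := by
  obtain ⟨f, hf, hfi, rfl, rfl, rfl⟩ := h
  exact ⟨g ∘ f, hg.comp_continuousOn hf, hi.comp_injOn hfi, rfl, rfl, image_comp g f _⟩

/-- Every continuous path that starts in a closed set has a last time in that set. -/
theorem exists_last_time {f : ℝ → ℝ × ℝ} {s t u : ℝ} (hf : ContinuousOn f (Icc s t))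
    {P : Set (ℝ × ℝ)} (hP : IsClosed P) (hu : u ∈ Icc s t) (hfu : f u ∈ P) :
    ∃ v ∈ Icc u t, f v ∈ P ∧ ∀ w ∈ Icc s t, f w ∈ P → w ≤ v := by
  have hc : IsCompact (Icc s t ∩ f ⁻¹' P) :=
    isCompact_Icc.of_isClosed_subset (hf.preimage_isClosed_of_isClosed isClosed_Icc hP)
      inter_subset_left
  obtain ⟨v, ⟨hv, hvP⟩, hmax⟩ := hc.exists_isGreatest ⟨u, hu, hfu⟩
  exact ⟨v, ⟨hmax ⟨hu, hfu⟩, hv.2⟩, hvP, fun w hw hwP => hmax ⟨hw, hwP⟩⟩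

theorem exists_first_time {f : ℝ → ℝ × ℝ} {s t u : ℝ} (hf : ContinuousOn f (Icc s t))
    {P : Set (ℝ × ℝ)} (hP : IsClosed P) (hu : u ∈ Icc s t) (hfu : f u ∈ P) :
    ∃ v ∈ Icc s u, f v ∈ P ∧ ∀ w ∈ Icc s t, f w ∈ P → v ≤ w := by
  have hc : IsCompact (Icc s t ∩ f ⁻¹' P) :=
    isCompact_Icc.of_isClosed_subset (hf.preimage_isClosed_of_isClosed isClosed_Icc hP)
      inter_subset_left
  obtain ⟨v, ⟨hv, hvP⟩, hmin⟩ := hc.exists_isLeast ⟨u, hu, hfu⟩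
  exact ⟨v, ⟨hv.1, hmin ⟨hu, hfu⟩⟩, hvP, fun w hw hwP => hmin ⟨hw, hwP⟩⟩

/-- A homeomorphism of the plane supported in a ball that moves the centre to a nearby point. -/
theorem exists_push_ball {a v : ℝ × ℝ} {ρ : ℝ} (hv : ‖v‖ < ρ) :
    ∃ h : (ℝ × ℝ) ≃ₜ (ℝ × ℝ), (∀ q ∉ Metric.ball a ρ, h q = q) ∧ h a = a + v := by
  have hρ : 0 < ρ := (norm_nonneg v).trans_lt hv
  set c : ℝ × ℝ → ℝ := fun q => max 0 (1 - ‖q - a‖ / ρ) with hc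
  have hclip : ∀ p q, |c p - c q| ≤ ‖p - q‖ / ρ := by
    intro p q
    calc |c p - c q| ≤ |(1 - ‖p - a‖ / ρ) - (1 - ‖q - a‖ / ρ)| := by
          simp only [hc]
          rw [max_comm 0, max_comm 0]
          exact abs_max_sub_max_le_abs _ _ _
      _ = |‖q - a‖ - ‖p - a‖| / ρ := by
          rw [← abs_of_pos hρ, ← abs_div, abs_of_pos hρ]
          congr 1
          ring
      _ ≤ ‖p - q‖ / ρ := by
          gcongr
          calc _ ≤ ‖(q - a) - (p - a)‖ := abs_norm_sub_norm_le _ _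
            _ = ‖p - q‖ := by rw [sub_sub_sub_cancel_right, norm_sub_rev]
  set f : ℝ × ℝ → ℝ × ℝ := fun q => q + c q • v with hf
  have happ : ApproximatesLinearOn f ((ContinuousLinearEquiv.refl ℝ (ℝ × ℝ) :
      (ℝ × ℝ) →L[ℝ] (ℝ × ℝ))) univ (‖v‖ / ρ).toNNReal := by
    intro p _ q _
    have : f p - f q - (p - q) = (c p - c q) • v := by
      simp only [hf, sub_smul]
      abel
    simp only [ContinuousLinearEquiv.coe_refl, ContinuousLinearMap.coe_id', id_eq, this,
      norm_smul, Real.norm_eq_abs, Real.coe_toNNReal _ (show 0 ≤ ‖v‖ / ρ by positivity)]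
    calc |c p - c q| * ‖v‖ ≤ ‖p - q‖ / ρ * ‖v‖ := by gcongr; exact hclip p q
      _ = ‖v‖ / ρ * ‖p - q‖ := by ring
  refine ⟨happ.toHomeomorph f (Or.inr ?_), ?_, ?_⟩
  · have h1 : ‖((ContinuousLinearEquiv.refl ℝ (ℝ × ℝ)).symm : (ℝ × ℝ) →L[ℝ] (ℝ × ℝ))‖₊⁻¹ = 1 := by
      simp
    rw [h1, Real.toNNReal_lt_one, div_lt_one hρ]
    exact hv
  · intro q hq
    have : c q = 0 := by
      simp only [hc, Metric.mem_ball, not_lt, dist_eq_norm] at hq ⊢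
      have : 1 ≤ ‖q - a‖ / ρ := by rwa [le_div_iff₀ hρ, one_mul]
      exact max_eq_left (by linarith)
    change f q = q
    simp [hf, this]
  · change f a = a + v
    simp [hf, hc]

/-- In an open connected subset `N` of the plane, any point can be moved to any other point by a
homeomorphism of the plane supported in `N`. -/
theorem exists_push {N : Set (ℝ × ℝ)} (hN : IsOpen N) (hNc : IsPreconnected N) {a b : ℝ × ℝ}
    (ha : a ∈ N) (hb : b ∈ N) :
    ∃ h : (ℝ × ℝ) ≃ₜ (ℝ × ℝ), (∀ q ∉ N, h q = q) ∧ h a = b := by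
  refine hNc.induction₂
    (fun a b => ∃ h : (ℝ × ℝ) ≃ₜ (ℝ × ℝ), (∀ q ∉ N, h q = q) ∧ h a = b) ?_ ?_ ?_ ha hb
  · intro x hx
    obtain ⟨ρ, hρ, hball⟩ := Metric.isOpen_iff.1 hN x hx
    filter_upwards [mem_nhdsWithin_of_mem_nhds (Metric.ball_mem_nhds x hρ)] with y hy
    obtain ⟨h, h1, h2⟩ := exists_push_ball (a := x) (v := y - x) (ρ := ρ)
      (by rwa [← dist_eq_norm])
    exact ⟨h, fun q hq => h1 q fun h' => hq (hball h'), by simp [h2]⟩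
  · rintro x y z - - - ⟨h, h1, h2⟩ ⟨k, k1, k2⟩
    exact ⟨h.trans k, fun q hq => by simp [h1 q hq, k1 q hq], by simp [h2, k2]⟩
  · rintro x y - - ⟨h, h1, h2⟩
    refine ⟨h.symm, fun q hq => ?_, by simp [← h2]⟩
    rw [Homeomorph.symm_apply_eq, h1 q hq]

/-- A closed set `P` with a base point `x` to which any two other points of `P` can be joined by
arcs in `P` that are disjoint apart from `x`. -/
structure IsPod (P : Set (ℝ × ℝ)) (x : ℝ × ℝ) : Prop where
  isClosed : IsClosed P
  exists_arcs : ∀ a ∈ P, ∀ b ∈ P, a ≠ x → b ≠ x → a ≠ b →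
    ∃ A B, A ⊆ P ∧ B ⊆ P ∧ IsArc A a x ∧ IsArc B b x ∧ A ∩ B ⊆ {x}

theorem IsPod.image {P : Set (ℝ × ℝ)} {x : ℝ × ℝ} (hP : IsPod P x) (h : (ℝ × ℝ) ≃ₜ (ℝ × ℝ)) :
    IsPod (h '' P) (h x) := by
  refine ⟨h.isClosedMap _ hP.isClosed, ?_⟩
  rintro _ ⟨a, ha, rfl⟩ _ ⟨b, hb, rfl⟩ hax hbx hab
  obtain ⟨A, B, hA, hB, hAa, hBb, hAB⟩ := hP.exists_arcs a ha b hb (fun h => hax (h ▸ rfl))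
    (fun h => hbx (h ▸ rfl)) (fun h => hab (h ▸ rfl))
  refine ⟨h '' A, h '' B, image_mono hA, image_mono hB, hAa.image h.continuous h.injective,
    hBb.image h.continuous h.injective, ?_⟩
  rw [← image_inter h.injective, ← image_singleton]
  exact image_mono hAB

/-- In a convex set with interior, two points on a common ray from `x` can be joined to `x` by arcs
that meet only at `x`. -/
theorem exists_arcs_of_same_ray {S : Set (ℝ × ℝ)} (hS : Convex ℝ S) (hint : (interior S).Nonempty)
    {x a : ℝ × ℝ} (hx : x ∈ S) (ha : a ∈ S) (hax : a ≠ x) {μ : ℝ} (hμ0 : 0 < μ) (hμ1 : μ < 1) :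
    ∃ A B, A ⊆ S ∧ B ⊆ S ∧ IsArc A a x ∧ IsArc B (x + μ • (a - x)) x ∧ A ∩ B ⊆ {x} := by
  obtain ⟨x1, x2⟩ := x
  obtain ⟨a1, a2⟩ := a
  have hL : 0 < (a1 - x1) ^ 2 + (a2 - x2) ^ 2 := by
    by_contra! h
    apply hax
    have h1 : a1 - x1 = 0 := by nlinarith [sq_nonneg (a1 - x1), sq_nonneg (a2 - x2)]
    have h2 : a2 - x2 = 0 := by nlinarith [sq_nonneg (a1 - x1), sq_nonneg (a2 - x2)]
    ext <;> simp <;> linarith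
  obtain ⟨⟨s1, s2⟩, hs, hω⟩ : ∃ s ∈ S, (a1 - x1) * (s.2 - x2) - (a2 - x2) * (s.1 - x1) ≠ 0 := by
    obtain ⟨⟨r1, r2⟩, hr⟩ := hint
    by_cases h0 : (a1 - x1) * (r2 - x2) - (a2 - x2) * (r1 - x1) = 0
    · have hc : Filter.Tendsto (fun t : ℝ => (r1 - t * (a2 - x2), r2 + t * (a1 - x1)))
          (nhdsWithin 0 (Ioi 0)) (nhds (r1, r2)) := by
        have : Continuous (fun t : ℝ => (r1 - t * (a2 - x2), r2 + t * (a1 - x1))) := by fun_prop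
        simpa using (this.tendsto 0).mono_left nhdsWithin_le_nhds
      obtain ⟨t, ht, ht0⟩ := ((hc.eventually (mem_interior_iff_mem_nhds.1 hr)).and
        self_mem_nhdsWithin).exists
      refine ⟨_, ht, ?_⟩
      have ht0 : 0 < t := ht0
      simp only
      have : (a1 - x1) * (r2 + t * (a1 - x1) - x2) - (a2 - x2) * (r1 - t * (a2 - x2) - x1) =
        t * ((a1 - x1) ^ 2 + (a2 - x2) ^ 2) := by linear_combination h0
      rw [this]
      positivity
    · exact ⟨_, interior_subset hr, h0⟩
  simp only at hω
  have hb : (x1, x2) + μ • ((a1, a2) - (x1, x2)) ∈ S :=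
    hS.add_smul_sub_mem hx ha ⟨hμ0.le, hμ1.le⟩
  refine ⟨segment ℝ (a1, a2) (s1, s2) ∪ segment ℝ (s1, s2) (x1, x2),
    segment ℝ ((x1, x2) + μ • ((a1, a2) - (x1, x2))) (x1, x2),
    union_subset (hS.segment_subset ha hs) (hS.segment_subset hs hx), hS.segment_subset hb hx,
    (isArc_segment ?_).union (isArc_segment ?_) ?_, isArc_segment ?_, ?_⟩
  · rintro h
    simp only [Prod.mk.injEq] at h
    obtain ⟨rfl, rfl⟩ := h
    apply hω; ring
  · rintro h
    simp only [Prod.mk.injEq] at h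
    obtain ⟨rfl, rfl⟩ := h
    apply hω; ring
  · rintro p ⟨⟨u, v, hu, hv, huv, rfl⟩, ⟨u', v', hu', hv', huv', h⟩⟩
    simp only [Prod.smul_mk, Prod.mk_add_mk, Prod.mk.injEq, smul_eq_mul, mem_singleton_iff] at h ⊢
    obtain ⟨h1, h2⟩ := h
    have e1 : (u' - v) * ((a1 - x1) * (s2 - x2) - (a2 - x2) * (s1 - x1)) = 0 := by
      obtain rfl : u = 1 - v := by linarith
      obtain rfl : v' = 1 - u' := by linarith
      linear_combination (a1 - x1) * h2 - (a2 - x2) * h1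
    have e2 : u' = v := by
      rcases mul_eq_zero.1 e1 with h | h
      · linarith
      · exact absurd h hω
    subst e2
    have e3 : u = v' := by linarith
    subst e3
    have e4 : u * (a1 - x1) = 0 := by linarith
    have e5 : u * (a2 - x2) = 0 := by linarith
    have e6 : u * ((a1 - x1) ^ 2 + (a2 - x2) ^ 2) = 0 := by
      linear_combination (a1 - x1) * e4 + (a2 - x2) * e5
    have e7 : u = 0 := by
      rcases mul_eq_zero.1 e6 with h | h
      · exact h
      · exact absurd h hL.ne'
    subst e7
    obtain rfl : u' = 1 := by linarith
    constructor <;> ring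
  · intro h
    apply hL.ne'
    simp only [Prod.mk_sub_mk, Prod.smul_mk, Prod.mk_add_mk, Prod.mk.injEq, smul_eq_mul,
      add_eq_left, mul_eq_zero] at h
    rcases h.1 with h' | h1
    · linarith
    rcases h.2 with h' | h2
    · linarith
    rw [h1, h2]; ring
  · rintro p ⟨hp | hp, hq⟩
    · exfalso
      obtain ⟨u, v, hu, hv, huv, rfl⟩ := hp
      obtain ⟨u', v', hu', hv', huv', h⟩ := hq
      simp only [Prod.mk_sub_mk, Prod.smul_mk, Prod.mk_add_mk, Prod.mk.injEq, smul_eq_mul] at h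
      obtain ⟨h1, h2⟩ := h
      obtain rfl : u = 1 - v := by linarith
      obtain rfl : v' = 1 - u' := by linarith
      have e1 : v * ((a1 - x1) * (s2 - x2) - (a2 - x2) * (s1 - x1)) = 0 := by
        linear_combination - (a1 - x1) * h2 + (a2 - x2) * h1
      have e2 : v = 0 := (mul_eq_zero.1 e1).resolve_right hω
      subst e2
      have e6 : (u' * μ - 1) * ((a1 - x1) ^ 2 + (a2 - x2) ^ 2) = 0 := by
        linear_combination (a1 - x1) * h1 + (a2 - x2) * h2
      have e7 := (mul_eq_zero.1 e6).resolve_right hL.ne'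
      nlinarith
    · obtain ⟨u, v, hu, hv, huv, rfl⟩ := hp
      obtain ⟨u', v', hu', hv', huv', h⟩ := hq
      simp only [Prod.mk_sub_mk, Prod.smul_mk, Prod.mk_add_mk, Prod.mk.injEq, smul_eq_mul,
        mem_singleton_iff] at h ⊢
      obtain ⟨h1, h2⟩ := h
      obtain rfl : v = 1 - u := by linarith
      obtain rfl : v' = 1 - u' := by linarith
      have e1 : u * ((a1 - x1) * (s2 - x2) - (a2 - x2) * (s1 - x1)) = 0 := by
        linear_combination - (a1 - x1) * h2 + (a2 - x2) * h1
      have e2 : u = 0 := (mul_eq_zero.1 e1).resolve_right hω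
      subst e2
      constructor <;> ring

theorem Convex.isPod {S : Set (ℝ × ℝ)} (hS : Convex ℝ S) (hint : (interior S).Nonempty)
    (hc : IsClosed S) {x : ℝ × ℝ} (hx : x ∈ S) : IsPod S x := by
  refine ⟨hc, fun a ha b hb hax hbx hab => ?_⟩
  by_cases hcol : segment ℝ a x ∩ segment ℝ b x ⊆ {x}
  · exact ⟨_, _, hS.segment_subset ha hx, hS.segment_subset hb hx, isArc_segment hax,
      isArc_segment hbx, hcol⟩
  · obtain ⟨p, ⟨hpa, hpb⟩, hpx⟩ := not_subset.1 hcol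
    rw [segment_symm, segment_eq_image'] at hpa hpb
    obtain ⟨s, hs, rfl⟩ := hpa
    obtain ⟨t, ht, h⟩ := hpb
    simp only [add_right_inj, mem_singleton_iff, add_eq_left] at h hpx
    have hs0 : 0 < s := hs.1.lt_of_ne (by rintro rfl; simp at hpx)
    have ht0 : 0 < t := ht.1.lt_of_ne (by rintro rfl; simp [← h] at hpx)
    have hba : b = x + (s / t) • (a - x) := by
      rw [div_eq_inv_mul, mul_smul, ← h, inv_smul_smul₀ ht0.ne']
      simp
    have hab' : a = x + (t / s) • (b - x) := by
      rw [div_eq_inv_mul, mul_smul, h, inv_smul_smul₀ hs0.ne']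
      simp
    rcases lt_trichotomy s t with hst | rfl | hst
    · have := exists_arcs_of_same_ray hS hint hx ha hax (div_pos hs0 ht0) ((div_lt_one ht0).2 hst)
      rwa [← hba] at this
    · rw [div_self hs0.ne', one_smul] at hba
      exact absurd (by simp [hba]) hab
    · obtain ⟨A, B, h1, h2, h3, h4, h5⟩ :=
        exists_arcs_of_same_ray hS hint hx hb hbx (div_pos ht0 hs0) ((div_lt_one hs0).2 hst)
      rw [← hab'] at h4
      exact ⟨B, A, h2, h1, h4, h3, by rwa [inter_comm]⟩

/-- Around an initial piece of the segment from `x` to `p` there is a thin convex wedge with apex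
`x` that avoids finitely many other segments emanating from `x`. -/
theorem exists_wedge {ι : Type*} [Finite ι] {x p : ℝ × ℝ} (hp : p ≠ x) (q : ι → ℝ × ℝ)
    (hq : ∀ i, q i ≠ x) (hpq : ∀ i, segment ℝ x p ∩ segment ℝ x (q i) ⊆ {x})
    {O : Set (ℝ × ℝ)} (hO : IsOpen O) (hx : x ∈ O) :
    ∃ S : Set (ℝ × ℝ), IsClosed S ∧ Convex ℝ S ∧ x ∈ S ∧ S ⊆ O ∧
      (∀ i, S ∩ segment ℝ x (q i) ⊆ {x}) ∧
      ∃ ε > (0 : ℝ), ∀ t : ℝ, 0 < t → t < ε → x + t • (p - x) ∈ interior S := by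
  obtain ⟨x1, x2⟩ := x
  obtain ⟨p1, p2⟩ := p
  set d1 := p1 - x1 with hd1
  set d2 := p2 - x2 with hd2
  have hL : 0 < d1 ^ 2 + d2 ^ 2 := by
    by_contra! h
    apply hp
    have h1 : d1 = 0 := by nlinarith [sq_nonneg d1, sq_nonneg d2]
    have h2 : d2 = 0 := by nlinarith [sq_nonneg d1, sq_nonneg d2]
    ext <;> simp <;> linarith
  set w : ℝ × ℝ → ℝ := fun z => d1 * (z.2 - x2) - d2 * (z.1 - x1) with hw
  set l : ℝ × ℝ → ℝ := fun z => d1 * (z.1 - x1) + d2 * (z.2 - x2) with hl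
  have hwc : Continuous w := by fun_prop
  have hlc : Continuous l := by fun_prop
  obtain ⟨δ, hδq, hδ1, hδ0⟩ : ∃ δ : ℝ, (∀ i, w (q i) ≠ 0 → δ * l (q i) < |w (q i)|) ∧
      δ < 1 ∧ 0 < δ := by
    have h1 : ∀ᶠ δ : ℝ in nhdsWithin 0 (Ioi 0), ∀ i, w (q i) ≠ 0 → δ * l (q i) < |w (q i)| := by
      rw [Filter.eventually_all]
      intro i
      by_cases hi : w (q i) = 0
      · simp [hi]
      · have : Filter.Tendsto (fun δ : ℝ => δ * l (q i)) (nhds 0) (nhds 0) := by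
          have : Continuous fun δ : ℝ => δ * l (q i) := by fun_prop
          simpa using this.tendsto 0
        filter_upwards [(this.mono_left nhdsWithin_le_nhds).eventually
          (gt_mem_nhds (abs_pos.2 hi))] with δ h _ using h
    have h2 : ∀ᶠ δ : ℝ in nhdsWithin 0 (Ioi 0), δ < 1 :=
      nhdsWithin_le_nhds (gt_mem_nhds one_pos)
    exact (h1.and (h2.and self_mem_nhdsWithin)).exists
  obtain ⟨ρ, hρ, hball⟩ := Metric.isOpen_iff.1 hO _ hx
  set η : ℝ := ρ * (d1 ^ 2 + d2 ^ 2) / (|d1| + |d2| + 1) with hη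
  have hη0 : 0 < η := by positivity
  have hηM : η * (|d1| + |d2|) < ρ * (d1 ^ 2 + d2 ^ 2) := by
    have : η * (|d1| + |d2| + 1) = ρ * (d1 ^ 2 + d2 ^ 2) := by
      rw [hη]; field_simp
    nlinarith
  refine ⟨{z | w z ≤ δ * l z ∧ -w z ≤ δ * l z ∧ l z ≤ η}, ?_, ?_, ?_, ?_, ?_, ?_⟩
  · simp only [ofPred_and]
    exact (isClosed_le hwc (by fun_prop)).inter
      ((isClosed_le (by fun_prop) (by fun_prop)).inter (isClosed_le hlc continuous_const))
  · rintro ⟨y1, y2⟩ ⟨hy1, hy2, hy3⟩ ⟨z1, z2⟩ ⟨hz1, hz2, hz3⟩ u v hu hv huv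
    obtain rfl : u = 1 - v := by linarith
    simp only [hw, hl, Prod.smul_mk, Prod.mk_add_mk, smul_eq_mul, mem_ofPred_eq] at *
    refine ⟨?_, ?_, ?_⟩ <;> nlinarith
  · simp [hw, hl, hη0.le]
  · rintro ⟨z1, z2⟩ ⟨hz1, hz2, hz3⟩
    apply hball
    have hl0 : 0 ≤ l (z1, z2) := by nlinarith
    have hwl : |w (z1, z2)| ≤ l (z1, z2) := abs_le.2 ⟨by nlinarith, by nlinarith⟩
    have hwη : |w (z1, z2)| ≤ η := hwl.trans hz3
    have hlη : |l (z1, z2)| ≤ η := by rwa [abs_of_nonneg hl0]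
    have e1 : |z1 - x1| * (d1 ^ 2 + d2 ^ 2) < ρ * (d1 ^ 2 + d2 ^ 2) := by
      calc |z1 - x1| * (d1 ^ 2 + d2 ^ 2) = |l (z1, z2) * d1 - w (z1, z2) * d2| := by
            rw [← abs_of_pos hL, ← abs_mul]
            congr 1
            simp only [hw, hl]; ring
        _ ≤ |l (z1, z2)| * |d1| + |w (z1, z2)| * |d2| := by
            rw [← abs_mul, ← abs_mul]; exact abs_sub _ _
        _ ≤ η * |d1| + η * |d2| := by gcongr
        _ < _ := by rwa [← mul_add]
    have e2 : |z2 - x2| * (d1 ^ 2 + d2 ^ 2) < ρ * (d1 ^ 2 + d2 ^ 2) := by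
      calc |z2 - x2| * (d1 ^ 2 + d2 ^ 2) = |l (z1, z2) * d2 + w (z1, z2) * d1| := by
            rw [← abs_of_pos hL, ← abs_mul]
            congr 1
            simp only [hw, hl]; ring
        _ ≤ |l (z1, z2)| * |d2| + |w (z1, z2)| * |d1| := by
            rw [← abs_mul, ← abs_mul]; exact abs_add_le _ _
        _ ≤ η * |d2| + η * |d1| := by gcongr
        _ < _ := by rwa [← mul_add, add_comm]
    rw [Metric.mem_ball, Prod.dist_eq, max_lt_iff, Real.dist_eq, Real.dist_eq]
    exact ⟨lt_of_mul_lt_mul_right e1 hL.le, lt_of_mul_lt_mul_right e2 hL.le⟩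
  · rintro i z ⟨⟨hz1, hz2, hz3⟩, hz⟩
    rw [segment_eq_image'] at hz
    obtain ⟨t, ht, rfl⟩ := hz
    rcases ht.1.eq_or_lt with rfl | ht0
    · simp
    exfalso
    have hwt : w ((x1, x2) + t • (q i - (x1, x2))) = t * w (q i) := by simp [hw]; ring
    have hlt : l ((x1, x2) + t • (q i - (x1, x2))) = t * l (q i) := by simp [hl]; ring
    simp only [hwt, hlt] at hz1 hz2
    have h1 : |w (q i)| ≤ δ * l (q i) := by
      rw [abs_le]
      have h2 : t * w (q i) ≤ t * (δ * l (q i)) := by linarith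
      have h3 : t * -w (q i) ≤ t * (δ * l (q i)) := by linarith
      exact ⟨by linarith [le_of_mul_le_mul_left h3 ht0], le_of_mul_le_mul_left h2 ht0⟩
    have hwi : w (q i) = 0 := by
      by_contra h
      exact absurd h1 (not_le.2 (hδq i h))
    have hli : 0 ≤ l (q i) := by
      rw [hwi, abs_zero] at h1
      exact nonneg_of_mul_nonneg_right h1 hδ0
    obtain ⟨c, hc, hqc⟩ : ∃ c : ℝ, 0 < c ∧ q i = (x1, x2) + c • ((p1, p2) - (x1, x2)) := by
      have e1 : (d1 ^ 2 + d2 ^ 2) * ((q i).1 - x1) = l (q i) * d1 := by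
        simp only [hw] at hwi
        simp only [hl]
        linear_combination (-d2) * hwi
      have e2 : (d1 ^ 2 + d2 ^ 2) * ((q i).2 - x2) = l (q i) * d2 := by
        simp only [hw] at hwi
        simp only [hl]
        linear_combination d1 * hwi
      have hqi : q i = (x1, x2) + (l (q i) / (d1 ^ 2 + d2 ^ 2)) • ((p1, p2) - (x1, x2)) := by
        ext
        · simp only [Prod.mk_sub_mk, Prod.smul_mk, Prod.mk_add_mk, smul_eq_mul, ← hd1]
          field_simp
          linarith
        · simp only [Prod.mk_sub_mk, Prod.smul_mk, Prod.mk_add_mk, smul_eq_mul, ← hd2]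
          field_simp
          linarith
      refine ⟨_, div_pos (hli.lt_of_ne fun h => ?_) hL, hqi⟩
      apply hq i
      rw [hqi, ← h]
      simp
    have hm := min_le_left 1 (c⁻¹)
    have hm' := min_le_right 1 (c⁻¹)
    have hm0 : 0 < min 1 c⁻¹ := lt_min one_pos (inv_pos.2 hc)
    have hmc : c * min 1 c⁻¹ ≤ 1 := by
      calc c * min 1 c⁻¹ ≤ c * c⁻¹ := by gcongr
        _ = 1 := mul_inv_cancel₀ hc.ne'
    have hmem : (x1, x2) + (c * min 1 c⁻¹) • ((p1, p2) - (x1, x2)) ∈ ({(x1, x2)} : Set (ℝ × ℝ)) := by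
      apply hpq i
      rw [segment_eq_image', segment_eq_image']
      refine ⟨⟨c * min 1 c⁻¹, ⟨by positivity, hmc⟩, rfl⟩, ⟨min 1 c⁻¹, ⟨hm0.le, hm⟩, ?_⟩⟩
      simp only [hqc, add_sub_cancel_left, smul_smul, mul_comm]
    rw [mem_singleton_iff, add_eq_left, smul_eq_zero, sub_eq_zero] at hmem
    rcases hmem with h | h
    · exact (mul_pos hc hm0).ne' h
    · exact hp h
  · refine ⟨η / (d1 ^ 2 + d2 ^ 2), by positivity, fun t ht0 ht => ?_⟩
    rw [lt_div_iff₀ hL] at ht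
    have hop : IsOpen {z | w z < δ * l z ∧ -w z < δ * l z ∧ l z < η} := by
      simp only [ofPred_and]
      exact (isOpen_lt hwc (by fun_prop)).inter
        ((isOpen_lt (by fun_prop) (by fun_prop)).inter (isOpen_lt hlc continuous_const))
    have hsub : {z | w z < δ * l z ∧ -w z < δ * l z ∧ l z < η} ⊆
        {z | w z ≤ δ * l z ∧ -w z ≤ δ * l z ∧ l z ≤ η} :=
      fun z hz => ⟨hz.1.le, hz.2.1.le, hz.2.2.le⟩
    apply interior_maximal hsub hop
    have hwt : w ((x1, x2) + t • ((p1, p2) - (x1, x2))) = 0 := by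
      simp [hw, ← hd1, ← hd2]; ring
    have hlt : l ((x1, x2) + t • ((p1, p2) - (x1, x2))) = t * (d1 ^ 2 + d2 ^ 2) := by
      simp [hl, ← hd1, ← hd2]; ring
    simp only [mem_ofPred_eq, hwt, hlt, neg_zero]
    exact ⟨by positivity, by positivity, ht⟩

/-- A proper crossing, expressed through an open embedding of the plane that parametrizes a
neighbourhood of the crossing point. -/
theorem properCross_iff {A B : Set (ℝ × ℝ)} {p : ℝ × ℝ} :
    ProperCross A B p ↔ ∃ ψ : ℝ × ℝ → ℝ × ℝ, Topology.IsOpenEmbedding ψ ∧ ψ 0 = p ∧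
      (∀ q, ψ q ∈ A ↔ q.2 = 0) ∧ ∀ q, ψ q ∈ B ↔ q.1 = 0 := by
  constructor
  · rintro ⟨U, hU, hp, φ, h0, hA, hB⟩
    have key : ∀ (C : Set (ℝ × ℝ)) (Z : Set (ℝ × ℝ)),
        (fun x => φ x) '' {x : U | (x : ℝ × ℝ) ∈ C} = Z → ∀ q, (φ.symm q : ℝ × ℝ) ∈ C ↔ q ∈ Z := by
      rintro C Z rfl q
      constructor
      · intro h
        exact ⟨φ.symm q, h, by simp⟩
      · rintro ⟨u, hu, rfl⟩
        simpa using hu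
    refine ⟨fun q => φ.symm q, hU.isOpenEmbedding_subtypeVal.comp φ.symm.isOpenEmbedding, ?_,
      key A _ hA, key B _ hB⟩
    have : φ.symm 0 = ⟨p, hp⟩ := by
      rw [Homeomorph.symm_apply_eq, h0]; rfl
    simp [this]
  · rintro ⟨ψ, hψ, rfl, hA, hB⟩
    have key : ∀ (C : Set (ℝ × ℝ)) (Z : Set (ℝ × ℝ)), (∀ q, ψ q ∈ C ↔ q ∈ Z) →
        (fun x => hψ.toIsEmbedding.toHomeomorph.symm x) ''
          {x : range ψ | (x : ℝ × ℝ) ∈ C} = Z := by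
      intro C Z h
      ext q
      constructor
      · rintro ⟨⟨_, r, rfl⟩, hu, rfl⟩
        have : hψ.toIsEmbedding.toHomeomorph.symm ⟨ψ r, r, rfl⟩ = r := by
          rw [Homeomorph.symm_apply_eq]; rfl
        simp only [this]
        exact (h r).1 hu
      · intro hq
        refine ⟨⟨ψ q, q, rfl⟩, (h q).2 hq, ?_⟩
        simp only
        rw [Homeomorph.symm_apply_eq]; rfl
    refine ⟨range ψ, hψ.isOpen_range, ⟨0, rfl⟩, hψ.toIsEmbedding.toHomeomorph.symm, ?_,
      key A _ hA, key B _ hB⟩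
    rw [Homeomorph.symm_apply_eq]; rfl

/-- The neighbourhood in the definition of a proper crossing may be taken arbitrarily small. -/
theorem ProperCross.exists_small {A B : Set (ℝ × ℝ)} {p : ℝ × ℝ} (h : ProperCross A B p)
    {W : Set (ℝ × ℝ)} (hW : W ∈ nhds p) :
    ∃ ψ : ℝ × ℝ → ℝ × ℝ, Topology.IsOpenEmbedding ψ ∧ ψ 0 = p ∧ (∀ q, ψ q ∈ W) ∧
      (∀ q, ψ q ∈ A ↔ q.2 = 0) ∧ ∀ q, ψ q ∈ B ↔ q.1 = 0 := by
  obtain ⟨ψ, hψ, rfl, hA, hB⟩ := properCross_iff.1 h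
  obtain ⟨r, hr, hball⟩ := Metric.mem_nhds_iff.1 (hψ.continuous.continuousAt hW)
  have hval : ∀ q : ℝ × ℝ, ∃ c : ℝ, c ≠ 0 ∧ OpenPartialHomeomorph.univBall (0 : ℝ × ℝ) r q = c • q := by
    intro q
    refine ⟨r * (Real.sqrt (1 + ‖q‖ ^ 2))⁻¹, by positivity, ?_⟩
    rw [OpenPartialHomeomorph.univBall, dif_pos hr]
    simp [OpenPartialHomeomorph.univUnitBall, smul_smul]
  refine ⟨ψ ∘ OpenPartialHomeomorph.univBall (0 : ℝ × ℝ) r,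
    hψ.comp (OpenPartialHomeomorph.isOpenEmbedding _ (by simp)), by simp, ?_, ?_, ?_⟩
  · intro q
    apply hball
    rw [← OpenPartialHomeomorph.univBall_target (0 : ℝ × ℝ) hr]
    exact OpenPartialHomeomorph.map_source _ (by simp)
  · intro q
    obtain ⟨c, hc, hq⟩ := hval q
    simp [hq, hA, hc]
  · intro q
    obtain ⟨c, hc, hq⟩ := hval q
    simp [hq, hB, hc]

theorem ProperCross.congr {A B A' B' : Set (ℝ × ℝ)} {p : ℝ × ℝ} (h : ProperCross A B p)
    (hA : ∀ᶠ q in nhds p, q ∈ A' ↔ q ∈ A) (hB : ∀ᶠ q in nhds p, q ∈ B' ↔ q ∈ B) :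
    ProperCross A' B' p := by
  obtain ⟨ψ, hψ, h0, hW, h1, h2⟩ := h.exists_small (hA.and hB)
  exact properCross_iff.2 ⟨ψ, hψ, h0, fun q => (hW q).1.trans (h1 q),
    fun q => (hW q).2.trans (h2 q)⟩

/-- Every edge of a drawing has a parametrization starting at a prescribed endpoint. -/
theorem Drawing.exists_param {V : Type*} {G : SimpleGraph V} (D : Drawing G) (e : G.edgeSet)
    {x : V} (hx : x ∈ (e : Sym2 V)) :
    ∃ (y : V) (f : ℝ → ℝ × ℝ), (e : Sym2 V) = s(x, y) ∧ x ≠ y ∧ ContinuousOn f (Icc 0 1) ∧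
      InjOn f (Icc 0 1) ∧ f 0 = D.pos x ∧ f 1 = D.pos y ∧ f '' Icc 0 1 = D.arcIm e := by
  obtain ⟨u, v, he, h0, h1⟩ := D.arc_ends e
  have huv : u ≠ v := by
    have := e.2
    rw [he, SimpleGraph.mem_edgeSet] at this
    exact this.ne
  rw [he, Sym2.mem_iff] at hx
  have harc : IsArc (D.arcIm e) (D.pos u) (D.pos v) :=
    ⟨D.arc e, D.arc_cont e, D.arc_inj e, h0, h1, rfl⟩
  rcases hx with rfl | rfl
  · obtain ⟨f, hf⟩ := harc
    exact ⟨v, f, he, huv, hf⟩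
  · obtain ⟨f, hf⟩ := harc.symm
    exact ⟨u, f, by rw [he, Sym2.eq_swap], huv.symm, hf⟩

theorem Drawing.isClosed_arcIm {V : Type*} {G : SimpleGraph V} (D : Drawing G) (e : G.edgeSet) :
    IsClosed (D.arcIm e) :=
  (isCompact_Icc.image_of_continuousOn (D.arc_cont e)).isClosed

/-- Replacing the arcs of a 1-planar drawing without creating new crossings, and without changing
the surviving crossings locally, yields a 1-planar drawing. -/
theorem Drawing.exists_redraw {V : Type*} [Finite V] {G : SimpleGraph V} (D : Drawing G)
    (hD : D.IsOnePlanar) (A : G.edgeSet → Set (ℝ × ℝ))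
    (hends : ∀ e : G.edgeSet, ∃ u v : V, (e : Sym2 V) = s(u, v) ∧ IsArc (A e) (D.pos u) (D.pos v))
    (hvert : ∀ (e : G.edgeSet) (v : V), v ∉ (e : Sym2 V) → D.pos v ∉ A e)
    (hcross : ∀ e₁ e₂ : G.edgeSet, e₁ ≠ e₂ → ∀ p ∈ A e₁ ∩ A e₂, p ∉ range D.pos →
      p ∈ D.arcIm e₁ ∧ p ∈ D.arcIm e₂ ∧ (∀ᶠ q in nhds p, q ∈ A e₁ ↔ q ∈ D.arcIm e₁) ∧
        ∀ᶠ q in nhds p, q ∈ A e₂ ↔ q ∈ D.arcIm e₂) :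
    ∃ D' : Drawing G, D'.IsOnePlanar ∧ D'.pos = D.pos ∧ (∀ e, D'.arcIm e = A e) ∧
      D'.crossings ⊆ D.crossings := by
  choose u v huv f hf hfi hf0 hf1 hfA using hends
  have hpos : ∀ e w, D.pos w ∈ A e → w ∈ (e : Sym2 V) := fun e w h => by
    by_contra hw
    exact hvert e w hw h
  let D' : Drawing G :=
    { pos := D.pos
      pos_inj := D.pos_inj
      arc := f
      arc_cont := hf
      arc_inj := hfi
      arc_ends := fun e => ⟨u e, v e, huv e, hf0 e, hf1 e⟩
      no_vertex_interior := by
        intro e w hw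
        rw [hfA]
        exact hvert e w hw
      shared_endpoint := by
        intro e₁ e₂ hne w h1 h2 p hp
        simp only [hfA] at hp
        by_cases hr : p ∈ range D.pos
        · obtain ⟨w', rfl⟩ := hr
          have h1' := hpos _ _ hp.1
          have h2' := hpos _ _ hp.2
          by_contra hww
          have hww' : w' ≠ w := fun h => hww (by simp [h])
          apply hne
          apply Subtype.ext
          rw [(Sym2.mem_and_mem_iff hww').1 ⟨h1', h1⟩, (Sym2.mem_and_mem_iff hww').1 ⟨h2', h2⟩]
        · obtain ⟨g1, g2, -⟩ := hcross e₁ e₂ hne p hp hr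
          exact D.shared_endpoint e₁ e₂ hne w h1 h2 ⟨g1, g2⟩
      finite_meet := by
        intro e₁ e₂ hne
        simp only [hfA]
        refine ((D.finite_meet e₁ e₂ hne).union (finite_range D.pos)).subset ?_
        intro p hp
        by_cases hr : p ∈ range D.pos
        · exact Or.inr hr
        · obtain ⟨g1, g2, -⟩ := hcross e₁ e₂ hne p hp hr
          exact Or.inl ⟨g1, g2⟩
      proper := by
        intro e₁ e₂ hne p hp hr
        simp only [hfA] at hp ⊢
        obtain ⟨g1, g2, g3, g4⟩ := hcross e₁ e₂ hne p hp hr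
        exact (D.proper e₁ e₂ hne p ⟨g1, g2⟩ hr).congr g3 g4
      at_most_two := by
        intro p hr e₁ e₂ e₃ h1 h2 h3
        simp only [hfA] at h1 h2 h3
        by_contra! h
        obtain ⟨n12, n13, n23⟩ := h
        have g1 := hcross e₁ e₂ n12 p ⟨h1, h2⟩ hr
        have g2 := hcross e₁ e₃ n13 p ⟨h1, h3⟩ hr
        rcases D.at_most_two p hr e₁ e₂ e₃ g1.1 g1.2.1 g2.2.1 with h | h | h
        exacts [n12 h, n13 h, n23 h] }
  have hsub : D'.crossings ⊆ D.crossings := by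
    rintro p ⟨hr, e₁, e₂, hne, h1, h2⟩
    obtain ⟨g1, g2, -⟩ := hcross e₁ e₂ hne p ⟨hfA e₁ ▸ h1, hfA e₂ ▸ h2⟩ hr
    exact ⟨hr, e₁, e₂, hne, g1, g2⟩
  have hinc : ∀ e p, p ∈ D'.crossings → p ∈ D'.arcIm e → p ∈ D.arcIm e := by
    rintro e p ⟨hr, e₁, e₂, hne, h1, h2⟩ he
    obtain ⟨e', hee', he'⟩ : ∃ e', e ≠ e' ∧ p ∈ D'.arcIm e' := by
      by_cases h : e = e₁
      · exact ⟨e₂, h ▸ hne, h2⟩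
      · exact ⟨e₁, h, h1⟩
    exact (hcross e e' hee' p ⟨hfA e ▸ he, hfA e' ▸ he'⟩ hr).1
  refine ⟨D', ?_, rfl, hfA, hsub⟩
  rintro e p ⟨hp, hpe⟩ q ⟨hq, hqe⟩
  exact hD e ⟨hsub hp, hinc e p hp hpe⟩ ⟨hsub hq, hinc e q hq hqe⟩

theorem eventually_mem_iff_of_isClosed {X : Type*} [TopologicalSpace X] {A B C : Set X} {c : X}
    (hC : IsClosed C) (hc : c ∉ C) (h : ∀ q ∉ C, q ∈ A ↔ q ∈ B) :
    ∀ᶠ q in nhds c, q ∈ A ↔ q ∈ B :=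
  Filter.mem_of_superset (hC.isOpen_compl.mem_nhds hc) h

/-- An arc can be straightened inside disjoint balls around its endpoints. -/
theorem IsArc.exists_straighten {A : Set (ℝ × ℝ)} {a b : ℝ × ℝ} (hA : IsArc A a b) {R : ℝ}
    (hR : 0 < R) (hab : Disjoint (Metric.closedBall a R) (Metric.closedBall b R)) :
    ∃ A' p q, IsArc A' a b ∧ p ∈ Metric.sphere a R ∧ q ∈ Metric.sphere b R ∧ p ∈ A ∧ q ∈ A ∧
      A' ∩ Metric.closedBall a R = segment ℝ a p ∧ A' ∩ Metric.closedBall b R = segment ℝ b q ∧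
      A' ⊆ A ∪ (Metric.closedBall a R ∪ Metric.closedBall b R) ∧
      ∀ c ∈ A', c ∉ Metric.closedBall a R → c ∉ Metric.closedBall b R →
        ∀ᶠ r in nhds c, r ∈ A' ↔ r ∈ A := by
  obtain ⟨f, hf, hi, rfl, rfl, rfl⟩ := hA
  have h0 : (0 : ℝ) ∈ Icc (0 : ℝ) 1 := by simp
  have h1 : (1 : ℝ) ∈ Icc (0 : ℝ) 1 := by simp
  have ha : f 0 ∈ Metric.closedBall (f 0) R := Metric.mem_closedBall_self hR.le
  have hb : f 1 ∈ Metric.closedBall (f 1) R := Metric.mem_closedBall_self hR.le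
  have hdis : ∀ p, p ∈ Metric.closedBall (f 0) R → p ∉ Metric.closedBall (f 1) R :=
    fun p hp hq => disjoint_left.1 hab hp hq
  obtain ⟨s, hs, hsP, hsmax⟩ := exists_last_time hf Metric.isClosed_closedBall h0 ha
  have hs1 : s < 1 := lt_of_le_of_ne hs.2 fun h => hdis _ hsP (h ▸ hb)
  have hfs : ContinuousOn f (Icc s 1) := hf.mono (Icc_subset_Icc_left hs.1)
  obtain ⟨t, ht, htP, htmin⟩ := exists_first_time hfs Metric.isClosed_closedBall
    (right_mem_Icc.2 hs1.le) hb
  have hst : s < t := lt_of_le_of_ne ht.1 fun h => hdis _ hsP (h ▸ htP)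
  have hss : f s ∈ Metric.sphere (f 0) R := by
    have hd : ContinuousOn (fun w => dist (f w) (f 0)) (Icc s 1) := by fun_prop
    obtain ⟨w, hw, hwR⟩ := intermediate_value_Icc hs1.le hd
      (show R ∈ Icc _ _ from ⟨hsP, (not_le.1 fun h => hdis _ h hb).le⟩)
    have : w = s := le_antisymm (hsmax w ⟨hs.1.trans hw.1, hw.2⟩ (le_of_eq hwR)) hw.1
    exact this ▸ hwR
  have htt : f t ∈ Metric.sphere (f 1) R := by
    have hd : ContinuousOn (fun w => dist (f w) (f 1)) (Icc s t) :=
      have := hfs.mono (Icc_subset_Icc_right ht.2)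
      by fun_prop
    obtain ⟨w, hw, hwR⟩ := intermediate_value_Icc' hst.le hd
      (show R ∈ Icc _ _ from ⟨htP, (not_le.1 fun h => hdis _ hsP h).le⟩)
    have : w = t := le_antisymm hw.2 (htmin w ⟨hw.1, hw.2.trans ht.2⟩ (le_of_eq hwR))
    exact this ▸ hwR
  have hsa : segment ℝ (f 0) (f s) ⊆ Metric.closedBall (f 0) R :=
    (convex_closedBall _ _).segment_subset ha hsP
  have hsb : segment ℝ (f 1) (f t) ⊆ Metric.closedBall (f 1) R :=
    (convex_closedBall _ _).segment_subset hb htP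
  have hmid : Icc s t ⊆ Icc 0 1 := Icc_subset_Icc hs.1 ht.2
  have hma : ∀ w ∈ Icc s t, f w ∈ Metric.closedBall (f 0) R → w = s := fun w hw h =>
    le_antisymm (hsmax w (hmid hw) h) hw.1
  have hmb : ∀ w ∈ Icc s t, f w ∈ Metric.closedBall (f 1) R → w = t := fun w hw h =>
    le_antisymm hw.2 (htmin w ⟨hw.1, hw.2.trans ht.2⟩ h)
  refine ⟨segment ℝ (f 0) (f s) ∪ f '' Icc s t ∪ segment ℝ (f 1) (f t), f s, f t, ?_, hss, htt,
    ⟨s, hs, rfl⟩, ⟨t, hmid (right_mem_Icc.2 hst.le), rfl⟩, ?_, ?_, ?_, ?_⟩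
  · have e1 : f 0 ≠ f s := fun h => by
      rw [← h, Metric.mem_sphere, dist_self] at hss; exact hR.ne hss
    have e2 : f 1 ≠ f t := fun h => by
      rw [← h, Metric.mem_sphere, dist_self] at htt; exact hR.ne htt
    refine ((isArc_segment e1).union (isArc_image_Icc hst (hf.mono hmid) (hi.mono hmid)) ?_).union
      (isArc_segment e2).symm ?_
    · rintro _ ⟨hp, w, hw, rfl⟩
      rw [hma w hw (hsa hp)]; rfl
    · rintro p ⟨hp | ⟨w, hw, rfl⟩, hq⟩
      · exact (hdis p (hsa hp) (hsb hq)).elim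
      · rw [hmb w hw (hsb hq)]; rfl
  · apply Subset.antisymm
    · rintro p ⟨(hp | ⟨w, hw, rfl⟩) | hp, hq⟩
      · exact hp
      · rw [hma w hw hq]; exact right_mem_segment _ _ _
      · exact (hdis p hq (hsb hp)).elim
    · exact fun p hp => ⟨Or.inl (Or.inl hp), hsa hp⟩
  · apply Subset.antisymm
    · rintro p ⟨(hp | ⟨w, hw, rfl⟩) | hp, hq⟩
      · exact (hdis p (hsa hp) hq).elim
      · rw [hmb w hw hq]; exact right_mem_segment _ _ _
      · exact hp
    · exact fun p hp => ⟨Or.inr hp, hsb hp⟩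
  · rintro p ((hp | ⟨w, hw, rfl⟩) | hp)
    · exact Or.inr (Or.inl (hsa hp))
    · exact Or.inl ⟨w, hmid hw, rfl⟩
    · exact Or.inr (Or.inr (hsb hp))
  · intro c hc hca hcb
    have hcl : ∀ u v, Icc u v ⊆ Icc (0 : ℝ) 1 → IsClosed (f '' Icc u v) := fun u v h =>
      (isCompact_Icc.image_of_continuousOn (hf.mono h)).isClosed
    have hw0 : Icc 0 s ⊆ Icc (0 : ℝ) 1 := Icc_subset_Icc_right hs.2
    have hw1 : Icc t 1 ⊆ Icc (0 : ℝ) 1 := Icc_subset_Icc_left (hs.1.trans ht.1)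
    refine eventually_mem_iff_of_isClosed (C := Metric.closedBall (f 0) R ∪
      Metric.closedBall (f 1) R ∪ f '' Icc 0 s ∪ f '' Icc t 1) (((Metric.isClosed_closedBall.union
      Metric.isClosed_closedBall).union (hcl _ _ hw0)).union (hcl _ _ hw1)) ?_ ?_
    · rcases hc with (hc | ⟨w, hw, rfl⟩) | hc
      · exact (hca (hsa hc)).elim
      · rintro (((h | h) | ⟨u, hu, h⟩) | ⟨u, hu, h⟩)
        · exact hca h
        · exact hcb h
        · have := hi (hw0 hu) (hmid hw) h
          have : w = s := le_antisymm (this ▸ hu.2) hw.1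
          exact hca (this ▸ hsP)
        · have := hi (hw1 hu) (hmid hw) h
          have : w = t := le_antisymm hw.2 (this ▸ hu.1)
          exact hcb (this ▸ htP)
      · exact (hcb (hsb hc)).elim
    · intro q hq
      simp only [mem_union, not_or] at hq
      constructor
      · rintro ((h | ⟨w, hw, rfl⟩) | h)
        · exact (hq.1.1.1 (hsa h)).elim
        · exact ⟨w, hmid hw, rfl⟩
        · exact (hq.1.1.2 (hsb h)).elim
      · rintro ⟨w, hw, rfl⟩
        refine Or.inl (Or.inr ⟨w, ⟨?_, ?_⟩, rfl⟩)
        · by_contra! h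
          exact hq.1.2 ⟨w, ⟨hw.1, h.le⟩, rfl⟩
        · by_contra! h
          exact hq.2 ⟨w, ⟨h.le, hw.2⟩, rfl⟩

theorem segment_inter_segment_subset_of_mem_sphere {x p q : ℝ × ℝ} {R : ℝ} (hR : 0 < R)
    (hp : p ∈ Metric.sphere x R) (hq : q ∈ Metric.sphere x R) (hpq : p ≠ q) :
    segment ℝ x p ∩ segment ℝ x q ⊆ {x} := by
  rintro r ⟨h1, h2⟩
  rw [segment_eq_image'] at h1 h2
  obtain ⟨s, hs, rfl⟩ := h1
  obtain ⟨t, ht, hst⟩ := h2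
  simp only [add_right_inj] at hst
  rw [mem_sphere_iff_norm] at hp hq
  have hn := congrArg norm hst
  rw [norm_smul, norm_smul, hp, hq, Real.norm_of_nonneg hs.1, Real.norm_of_nonneg ht.1] at hn
  have hts : t = s := mul_right_cancel₀ hR.ne' hn
  subst hts
  by_cases h0 : t = 0
  · simp [h0]
  · have := smul_right_injective (ℝ × ℝ) h0 hst
    exact (hpq (sub_left_injective this).symm).elim

/-- Every edge is drawn straight within distance `R` of its endpoints, and stays at distance more
than `R` from all other vertices. -/
def Drawing.IsStraightNear {V : Type*} {G : SimpleGraph V} (D : Drawing G) (R : ℝ) : Prop :=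
  ∀ (e : G.edgeSet) (v : V),
    (v ∈ (e : Sym2 V) → ∃ p ∈ Metric.sphere (D.pos v) R,
      D.arcIm e ∩ Metric.closedBall (D.pos v) R = segment ℝ (D.pos v) p) ∧
    (v ∉ (e : Sym2 V) → Disjoint (D.arcIm e) (Metric.closedBall (D.pos v) R))

theorem eventually_disjoint_closedBall {C : Set (ℝ × ℝ)} {p : ℝ × ℝ} (hC : IsClosed C)
    (hp : p ∉ C) : ∀ᶠ R in nhdsWithin (0 : ℝ) (Ioi 0), Disjoint C (Metric.closedBall p R) := by
  obtain ⟨ε, hε, h⟩ := Metric.nhds_basis_closedBall.mem_iff.1 (hC.isOpen_compl.mem_nhds hp)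
  filter_upwards [Ioo_mem_nhdsGT hε] with R hR
  exact disjoint_right.2 fun q hq => h (Metric.closedBall_subset_closedBall hR.2.le hq)

theorem Drawing.exists_isStraightNear {V : Type*} [Finite V] {G : SimpleGraph V} (D : Drawing G)
    (hD : D.IsOnePlanar) :
    ∃ D' : Drawing G, D'.IsOnePlanar ∧ D'.crossings ⊆ D.crossings ∧
      (∀ p ∈ D'.crossings, ∀ e, p ∈ D'.arcIm e → p ∈ D.arcIm e) ∧
      ∃ R > 0, D'.IsStraightNear R := by
  obtain ⟨R, ⟨hRv, hRe⟩, hR⟩ : ∃ R : ℝ, ((∀ u v : V, u ≠ v →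
      Disjoint (Metric.closedBall (D.pos u) R) (Metric.closedBall (D.pos v) R)) ∧
      ∀ (e : G.edgeSet) (v : V), v ∉ (e : Sym2 V) →
        Disjoint (D.arcIm e) (Metric.closedBall (D.pos v) R)) ∧ 0 < R := by
    have h1 : ∀ᶠ R in nhdsWithin (0 : ℝ) (Ioi 0), ∀ u v : V, u ≠ v →
        Disjoint (Metric.closedBall (D.pos u) R) (Metric.closedBall (D.pos v) R) := by
      simp only [Filter.eventually_all]
      intro u v huv
      have hd : 0 < dist (D.pos u) (D.pos v) := dist_pos.2 (D.pos_inj.ne huv)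
      filter_upwards [Ioo_mem_nhdsGT (half_pos hd)] with R hR
      exact Metric.closedBall_disjoint_closedBall (by linarith [hR.2])
    have h2 : ∀ᶠ R in nhdsWithin (0 : ℝ) (Ioi 0), ∀ (e : G.edgeSet) (v : V), v ∉ (e : Sym2 V) →
        Disjoint (D.arcIm e) (Metric.closedBall (D.pos v) R) := by
      simp only [Filter.eventually_all]
      exact fun e v hv => eventually_disjoint_closedBall (D.isClosed_arcIm e)
        (D.no_vertex_interior e v hv)
    exact ((h1.and h2).and self_mem_nhdsWithin).exists
  have hA : ∀ e : G.edgeSet, ∃ A : Set (ℝ × ℝ),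
      (∃ u v : V, (e : Sym2 V) = s(u, v) ∧ IsArc A (D.pos u) (D.pos v)) ∧
      (∀ v ∈ (e : Sym2 V), ∃ p ∈ Metric.sphere (D.pos v) R, p ∈ D.arcIm e ∧
        A ∩ Metric.closedBall (D.pos v) R = segment ℝ (D.pos v) p) ∧
      (∀ v ∉ (e : Sym2 V), Disjoint A (Metric.closedBall (D.pos v) R)) ∧
      ∀ c ∈ A, (∀ v, c ∉ Metric.closedBall (D.pos v) R) →
        ∀ᶠ r in nhds c, r ∈ A ↔ r ∈ D.arcIm e := by
    intro e
    obtain ⟨u, v, he, h0, h1⟩ := D.arc_ends e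
    have huv : u ≠ v := by
      have := e.2
      rw [he, SimpleGraph.mem_edgeSet] at this
      exact this.ne
    have harc : IsArc (D.arcIm e) (D.pos u) (D.pos v) :=
      ⟨D.arc e, D.arc_cont e, D.arc_inj e, h0, h1, rfl⟩
    obtain ⟨A, p, q, hA, hp, hq, hpA, hqA, hAp, hAq, hsub, hloc⟩ :=
      harc.exists_straighten hR (hRv u v huv)
    refine ⟨A, ⟨u, v, he, hA⟩, ?_, ?_, fun c hc hv => hloc c hc (hv u) (hv v)⟩
    · intro w hw
      rw [he, Sym2.mem_iff] at hw
      rcases hw with rfl | rfl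
      · exact ⟨p, hp, hpA, hAp⟩
      · exact ⟨q, hq, hqA, hAq⟩
    · intro w hw
      have hw' := hw
      rw [he, Sym2.mem_iff, not_or] at hw'
      refine disjoint_left.2 fun r hr hrw => ?_
      rcases hsub hr with h | h | h
      · exact disjoint_left.1 (hRe e w hw) h hrw
      · exact disjoint_left.1 (hRv w u hw'.1) hrw h
      · exact disjoint_left.1 (hRv w v hw'.2) hrw h
  choose A hends hin hout hloc using hA
  have hcross : ∀ e₁ e₂ : G.edgeSet, e₁ ≠ e₂ → ∀ p ∈ A e₁ ∩ A e₂, p ∉ range D.pos →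
      p ∈ D.arcIm e₁ ∧ p ∈ D.arcIm e₂ ∧ (∀ᶠ q in nhds p, q ∈ A e₁ ↔ q ∈ D.arcIm e₁) ∧
        ∀ᶠ q in nhds p, q ∈ A e₂ ↔ q ∈ D.arcIm e₂ := by
    intro e₁ e₂ hne p hp hr
    have hb : ∀ v, p ∉ Metric.closedBall (D.pos v) R := by
      intro v hv
      have hv1 : v ∈ (e₁ : Sym2 V) := by
        by_contra h
        exact disjoint_left.1 (hout e₁ v h) hp.1 hv
      have hv2 : v ∈ (e₂ : Sym2 V) := by
        by_contra h
        exact disjoint_left.1 (hout e₂ v h) hp.2 hv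
      obtain ⟨q₁, hq₁, hq₁A, hs₁⟩ := hin e₁ v hv1
      obtain ⟨q₂, hq₂, hq₂A, hs₂⟩ := hin e₂ v hv2
      have hq : q₁ ≠ q₂ := by
        rintro rfl
        have := D.shared_endpoint e₁ e₂ hne v hv1 hv2 ⟨hq₁A, hq₂A⟩
        rw [mem_singleton_iff] at this
        rw [this, Metric.mem_sphere, dist_self] at hq₁
        exact hR.ne hq₁
      have := segment_inter_segment_subset_of_mem_sphere hR hq₁ hq₂ hq
        ⟨hs₁.subset ⟨hp.1, hv⟩, hs₂.subset ⟨hp.2, hv⟩⟩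
      exact hr ⟨v, this.symm⟩
    have l1 := hloc e₁ p hp.1 hb
    have l2 := hloc e₂ p hp.2 hb
    exact ⟨l1.self_of_nhds.1 hp.1, l2.self_of_nhds.1 hp.2, l1, l2⟩
  have hvert : ∀ (e : G.edgeSet) (v : V), v ∉ (e : Sym2 V) → D.pos v ∉ A e := fun e v hv h =>
    disjoint_left.1 (hout e v hv) h (Metric.mem_closedBall_self hR.le)
  obtain ⟨D', hD', hpos, harc, hsub⟩ := D.exists_redraw hD A hends hvert hcross
  refine ⟨D', hD', hsub, ?_, R, hR, ?_⟩
  · rintro p ⟨hr, e₁, e₂, hne, h1, h2⟩ e he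
    obtain ⟨e', hee', he'⟩ : ∃ e', e ≠ e' ∧ p ∈ D'.arcIm e' := by
      by_cases h : e = e₁
      · exact ⟨e₂, h ▸ hne, h2⟩
      · exact ⟨e₁, h, h1⟩
    exact (hcross e e' hee' p ⟨harc e ▸ he, harc e' ▸ he'⟩ (hpos ▸ hr)).1
  · intro e v
    rw [hpos, harc]
    refine ⟨fun hv => ?_, hout e v⟩
    obtain ⟨p, hp, -, h⟩ := hin e v hv
    exact ⟨p, hp, h⟩

/-- An initial segment of an edge that meets no other edge has a neighbourhood, as far as its
far end is concerned, that meets the other edges only at the initial vertex. -/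
theorem Drawing.exists_isPod {V : Type*} [Finite V] {G : SimpleGraph V} (D : Drawing G) {R : ℝ}
    (hR : 0 < R) (hDR : D.IsStraightNear R) {e₁ : G.edgeSet} {x : V} (hx : x ∈ (e₁ : Sym2 V))
    {f : ℝ → ℝ × ℝ} (hf : ContinuousOn f (Icc 0 1)) (hi : InjOn f (Icc 0 1))
    (hf0 : f 0 = D.pos x) (hfe : f '' Icc 0 1 = D.arcIm e₁) {τ : ℝ} (hτ : 0 < τ) (hτ1 : τ ≤ 1)
    {O : Set (ℝ × ℝ)} (hO : IsOpen O) (hfO : ∀ t ∈ Icc 0 τ, f t ∈ O)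
    (hother : ∀ e, e ≠ e₁ → ∀ t ∈ Ioc 0 τ, f t ∉ D.arcIm e) :
    ∃ P, IsPod P (D.pos x) ∧ D.pos x ∈ P ∧ f τ ∈ interior P ∧ P ⊆ O ∧
      ∀ e, e ≠ e₁ → P ∩ D.arcIm e ⊆ {D.pos x} := by
  have hsph : ∀ q ∈ Metric.sphere (D.pos x) R, q ≠ D.pos x := by
    rintro q hq rfl
    rw [Metric.mem_sphere, dist_self] at hq
    exact hR.ne hq
  obtain ⟨p, hp, hps⟩ := (hDR e₁ x).1 hx
  choose q hq hqs using fun e : {e : G.edgeSet // e ≠ e₁ ∧ x ∈ (e : Sym2 V)} => (hDR e.1 x).1 e.2.2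
  have hpq : ∀ e, segment ℝ (D.pos x) p ∩ segment ℝ (D.pos x) (q e) ⊆ {D.pos x} := by
    intro e
    refine segment_inter_segment_subset_of_mem_sphere hR hp (hq e) fun h => hsph p hp ?_
    have h1 := (hps.superset (right_mem_segment _ _ _)).1
    have h2 := ((hqs e).superset (right_mem_segment _ _ _)).1
    exact D.shared_endpoint e.1 e₁ e.2.1 x e.2.2 hx ⟨h ▸ h2, h1⟩
  obtain ⟨S, hSc, hSconv, hxS, hSO, hSq, ε, hε, hSε⟩ := exists_wedge (hsph p hp) q
    (fun e => hsph _ (hq e)) hpq (hO.inter (Metric.isOpen_ball (x := D.pos x) (ε := R)))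
    ⟨hf0 ▸ hfO 0 ⟨le_rfl, hτ.le⟩, Metric.mem_ball_self hR⟩
  have hSe : ∀ e, e ≠ e₁ → S ∩ D.arcIm e ⊆ {D.pos x} := by
    rintro e he r ⟨hrS, hre⟩
    have hrb := Metric.ball_subset_closedBall (hSO hrS).2
    by_cases hxe : x ∈ (e : Sym2 V)
    · exact hSq ⟨e, he, hxe⟩ ⟨hrS, (hqs ⟨e, he, hxe⟩).subset ⟨hre, hrb⟩⟩
    · exact (disjoint_left.1 ((hDR e x).2 hxe) hre hrb).elim
  obtain ⟨δ, hδ, hδτ, hδS⟩ : ∃ δ, 0 < δ ∧ δ ≤ τ ∧ f δ ∈ interior S := by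
    obtain ⟨η, hη, hηf⟩ := Metric.continuousWithinAt_iff.1 (hf 0 ⟨le_rfl, zero_le_one⟩) (min R (ε * R))
      (by positivity)
    have h1 : 0 < min (η / 2) τ := by positivity
    have h2 : min (η / 2) τ ∈ Icc (0 : ℝ) 1 := ⟨h1.le, (min_le_right _ _).trans hτ1⟩
    have h3 : dist (f (min (η / 2) τ)) (f 0) < min R (ε * R) := by
      apply hηf h2
      rw [Real.dist_eq, sub_zero, abs_of_pos h1]
      linarith [min_le_left (η / 2) τ]
    refine ⟨min (η / 2) τ, h1, min_le_right _ _, ?_⟩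
    have h4 : f (min (η / 2) τ) ∈ segment ℝ (D.pos x) p := by
      rw [← hps, ← hfe]
      refine ⟨⟨_, h2, rfl⟩, ?_⟩
      rw [← hf0]
      exact (h3.le.trans (min_le_left _ _))
    have h5 : f (min (η / 2) τ) ≠ D.pos x := fun h => h1.ne' (hi h2 ⟨le_rfl, zero_le_one⟩
      (h.trans hf0.symm))
    rw [segment_eq_image'] at h4
    obtain ⟨t, ht, hft⟩ := h4
    simp only at hft
    rw [hf0, ← hft, dist_eq_norm, add_sub_cancel_left, norm_smul, mem_sphere_iff_norm.1 hp,
      Real.norm_of_nonneg ht.1] at h3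
    rw [← hft] at h5 ⊢
    apply hSε
    · refine lt_of_le_of_ne ht.1 ?_
      rintro rfl
      simp at h5
    · exact lt_of_mul_lt_mul_right (h3.trans_le (min_le_right _ _)) hR.le
  set C : Set (ℝ × ℝ) := {D.pos x} ∪ ⋃ e : {e : G.edgeSet // e ≠ e₁}, D.arcIm e with hC
  have hCc : IsClosed C := isClosed_singleton.union
    (isClosed_iUnion_of_finite fun e => D.isClosed_arcIm _)
  have hfC : ∀ t ∈ Icc δ τ, f t ∈ O ∩ Cᶜ := by
    intro t ht
    refine ⟨hfO t ⟨hδ.le.trans ht.1, ht.2⟩, ?_⟩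
    rintro (h | h)
    · have : t = 0 := hi ⟨hδ.le.trans ht.1, ht.2.trans hτ1⟩ ⟨le_rfl, zero_le_one⟩ (h.trans hf0.symm)
      linarith [ht.1]
    · obtain ⟨e, he⟩ := mem_iUnion.1 h
      exact hother e e.2 t ⟨hδ.trans_le ht.1, ht.2⟩ he
  set N := connectedComponentIn (O ∩ Cᶜ) (f τ) with hN
  have hfN : f '' Icc δ τ ⊆ N := by
    apply IsPreconnected.subset_connectedComponentIn
    · exact isPreconnected_Icc.image _ (hf.mono (Icc_subset_Icc hδ.le hτ1))
    · exact ⟨τ, right_mem_Icc.2 hδτ, rfl⟩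
    · rintro _ ⟨t, ht, rfl⟩
      exact hfC t ht
  have hNs : N ⊆ O ∩ Cᶜ := connectedComponentIn_subset _ _
  obtain ⟨h, hfix, hh⟩ := exists_push (hO.inter hCc.isOpen_compl).connectedComponentIn
    isPreconnected_connectedComponentIn (hfN ⟨δ, left_mem_Icc.2 hδτ, rfl⟩)
    (hfN ⟨τ, right_mem_Icc.2 hδτ, rfl⟩)
  have hhx : h (D.pos x) = D.pos x := hfix _ fun hx' => (hNs hx').2 (Or.inl rfl)
  have hsub : h '' S ⊆ S ∪ N := by
    rintro _ ⟨r, hr, rfl⟩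
    by_cases hrN : r ∈ N
    · right
      by_contra hc
      have := h.injective (hfix _ hc)
      exact hc (this.symm ▸ hrN)
    · left
      rwa [hfix r hrN]
  have hpod := (hSconv.isPod ⟨_, hδS⟩ hSc hxS).image h
  rw [hhx] at hpod
  refine ⟨h '' S, hpod, ⟨_, hxS, hhx⟩, ?_, ?_, ?_⟩
  · rw [← h.image_interior]
    exact ⟨_, hδS, hh⟩
  · intro r hr
    rcases hsub hr with h | h
    · exact (hSO h).1
    · exact (hNs h).1
  · rintro e he r ⟨hr, hre⟩
    rcases hsub hr with h | h
    · exact hSe e he ⟨h, hre⟩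
    · exact ((hNs h).2 (Or.inr (mem_iUnion.2 ⟨⟨e, he⟩, hre⟩))).elim

/-- Rerouting a path that ends outside a pod: it can be made to reach the centre of the pod
directly, leaving room for a second arc from a prescribed point of the pod to its centre. -/
theorem IsPod.exists_reroute {P : Set (ℝ × ℝ)} {x b : ℝ × ℝ} (hP : IsPod P x)
    {f : ℝ → ℝ × ℝ} (hf : ContinuousOn f (Icc 0 1)) (hi : InjOn f (Icc 0 1)) (hf0 : f 0 = x)
    {τ : ℝ} (hτ : 0 < τ) (hτ1 : τ ≤ 1) (hfτ : f τ ∈ P) (hf1 : f 1 ∉ P) (hb : b ∈ P)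
    (hbx : b ≠ x) (hbf : b ∉ f '' Icc 0 1) :
    ∃ A B, IsArc A x (f 1) ∧ IsArc B b x ∧ B ⊆ P ∧ A ∩ B ⊆ {x} ∧ A ⊆ P ∪ f '' Icc 0 1 ∧
      ∀ c ∈ A, c ∉ P → ∀ᶠ q in nhds c, q ∈ A ↔ q ∈ f '' Icc 0 1 := by
  obtain ⟨σ, hσ, hσP, hmax⟩ := exists_last_time hf hP.isClosed ⟨hτ.le, hτ1⟩ hfτ
  have hσ0 : 0 < σ := hτ.trans_le hσ.1
  have hσ1 : σ < 1 := lt_of_le_of_ne hσ.2 fun h => hf1 (h ▸ hσP)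
  have hσm : σ ∈ Icc (0 : ℝ) 1 := ⟨hσ0.le, hσ1.le⟩
  have hfσ : f σ ≠ x := fun h => hσ0.ne' (hi hσm ⟨le_rfl, zero_le_one⟩ (h.trans hf0.symm))
  have hsub : Icc σ 1 ⊆ Icc 0 1 := Icc_subset_Icc_left hσ0.le
  have hmeet : ∀ w ∈ Icc σ 1, f w ∈ P → w = σ := fun w hw h =>
    le_antisymm (hmax w (hsub hw) h) hw.1
  obtain ⟨A, B, hAP, hBP, hA, hB, hAB⟩ := hP.exists_arcs (f σ) hσP b hb hfσ hbx
    fun h => hbf ⟨σ, hσm, h⟩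
  have hσA : f σ ∈ A := by
    obtain ⟨g, -, -, h0, -, rfl⟩ := hA
    exact ⟨0, ⟨le_rfl, zero_le_one⟩, h0⟩
  refine ⟨A ∪ f '' Icc σ 1, B, hA.symm.union (isArc_image_Icc hσ1 (hf.mono hsub) (hi.mono hsub)) ?_,
    hB, hBP, ?_, union_subset_union hAP (image_mono hsub), ?_⟩
  · rintro _ ⟨hp, w, hw, rfl⟩
    rw [hmeet w hw (hAP hp)]; rfl
  · rintro p ⟨hp | ⟨w, hw, rfl⟩, hpB⟩
    · exact hAB ⟨hp, hpB⟩
    · have hwσ := hmeet w hw (hBP hpB)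
      rw [hwσ] at hpB ⊢
      exact hAB ⟨hσA, hpB⟩
  · intro c hc hcP
    have hsub' : Icc 0 σ ⊆ Icc (0 : ℝ) 1 := Icc_subset_Icc_right hσ1.le
    refine eventually_mem_iff_of_isClosed (C := P ∪ f '' Icc 0 σ) (hP.isClosed.union
      (isCompact_Icc.image_of_continuousOn (hf.mono hsub')).isClosed) ?_ ?_
    · rintro (h | ⟨u, hu, hfu⟩)
      · exact hcP h
      · rcases hc with hc | ⟨w, hw, rfl⟩
        · exact hcP (hAP hc)
        · have : u = w := hi (hsub' hu) (hsub hw) hfu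
          have : w = σ := le_antisymm (this ▸ hu.2) hw.1
          exact hcP (this ▸ hσP)
    · intro q hq
      rw [mem_union, not_or] at hq
      constructor
      · rintro (h | ⟨w, hw, rfl⟩)
        · exact (hq.1 (hAP h)).elim
        · exact ⟨w, hsub hw, rfl⟩
      · rintro ⟨w, hw, rfl⟩
        refine Or.inr ⟨w, ⟨?_, hw.2⟩, rfl⟩
        by_contra! h
        exact hq.2 ⟨w, ⟨hw.1, h.le⟩, rfl⟩

/-- A crossed edge of a 1-planar drawing, parametrized from one of its endpoints, meets the other
edges away from the vertices only at the crossing. -/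
theorem Drawing.IsOnePlanar.exists_param {V : Type*} {G : SimpleGraph V} {D : Drawing G}
    (hD : D.IsOnePlanar) {e₁ e₂ : G.edgeSet} (hne : e₁ ≠ e₂) {c : ℝ × ℝ} (hc : c ∉ range D.pos)
    (hc₁ : c ∈ D.arcIm e₁) (hc₂ : c ∈ D.arcIm e₂) {x : V} (hx : x ∈ (e₁ : Sym2 V)) :
    ∃ (y : V) (f : ℝ → ℝ × ℝ) (τ : ℝ), (e₁ : Sym2 V) = s(x, y) ∧ x ≠ y ∧
      ContinuousOn f (Icc 0 1) ∧ InjOn f (Icc 0 1) ∧ f 0 = D.pos x ∧ f 1 = D.pos y ∧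
      f '' Icc 0 1 = D.arcIm e₁ ∧ τ < 1 ∧ f τ = c ∧
      (∀ e, e ≠ e₁ → ∀ t ∈ Ioo 0 τ, f t ∉ D.arcIm e) ∧
      ∀ U ∈ nhds c, ∃ t ∈ Ioo 0 τ, f t ∈ U := by
  obtain ⟨y, f, he, hxy, hf, hi, hf0, hf1, hfe⟩ := D.exists_param e₁ hx
  obtain ⟨τ, hτ, hfτ⟩ : c ∈ f '' Icc 0 1 := hfe ▸ hc₁
  have h0 : 0 < τ := lt_of_le_of_ne hτ.1 (by rintro rfl; exact hc ⟨x, hf0.symm.trans hfτ⟩)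
  have h1 : τ < 1 := lt_of_le_of_ne hτ.2 (by rintro rfl; exact hc ⟨y, hf1.symm.trans hfτ⟩)
  refine ⟨y, f, τ, he, hxy, hf, hi, hf0, hf1, hfe, h1, hfτ, ?_, ?_⟩
  · intro e hee t ht hte
    have htm : t ∈ Icc (0 : ℝ) 1 := ⟨ht.1.le, (ht.2.trans h1).le⟩
    have hte₁ : f t ∈ D.arcIm e₁ := hfe ▸ ⟨t, htm, rfl⟩
    have hr : f t ∉ range D.pos := by
      rintro ⟨w, hw⟩
      have hwe : w ∈ (e₁ : Sym2 V) := by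
        by_contra h
        exact D.no_vertex_interior e₁ w h (hw ▸ hte₁)
      rw [he, Sym2.mem_iff] at hwe
      rcases hwe with rfl | rfl
      · exact ht.1.ne' (hi htm ⟨le_rfl, zero_le_one⟩ (hw.symm.trans hf0.symm))
      · exact (ht.2.trans h1).ne (hi htm ⟨zero_le_one, le_rfl⟩ (hw.symm.trans hf1.symm))
    have := hD e₁ ⟨⟨hr, e, e₁, hee, hte, hte₁⟩, hte₁⟩ ⟨⟨hc, e₁, e₂, hne, hc₁, hc₂⟩, hc₁⟩
    exact ht.2.ne (hi htm hτ (this.trans hfτ.symm))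
  · intro U hU
    rw [← hfτ] at hU
    have hcont : ContinuousWithinAt f (Iio τ) τ :=
      (hf.continuousAt (Icc_mem_nhds h0 h1)).continuousWithinAt
    have := (hcont.eventually hU).and (Ioo_mem_nhdsLT h0)
    obtain ⟨t, htU, ht⟩ := this.exists
    exact ⟨t, ht, htU⟩

/-- In the complement of the axes, two points on different half-axes are joined by a segment up to
an arbitrarily small perturbation. -/
theorem exists_segment_avoiding_axes {P Q : Set (ℝ × ℝ)} {s s' : ℝ} (hs : s ≠ 0) (hs' : s' ≠ 0)
    (hP : P ∈ nhds (s, (0 : ℝ))) (hQ : Q ∈ nhds ((0 : ℝ), s')) :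
    ∃ g : ℝ → ℝ × ℝ, Continuous g ∧ Function.Injective g ∧ g 0 ∈ P ∧ g 1 ∈ Q ∧
      ∀ t ∈ Icc (0 : ℝ) 1, (g t).1 ≠ 0 ∧ (g t).2 ≠ 0 := by
  have h1 : ∀ᶠ ε in nhds (0 : ℝ), (s, ε * s') ∈ P := by
    have : Filter.Tendsto (fun ε : ℝ => (s, ε * s')) (nhds 0) (nhds (s, 0)) := by
      have : Continuous (fun ε : ℝ => (s, ε * s')) := by fun_prop
      simpa using this.tendsto 0
    exact this hP
  have h2 : ∀ᶠ ε in nhds (0 : ℝ), (ε * s, s') ∈ Q := by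
    have : Filter.Tendsto (fun ε : ℝ => (ε * s, s')) (nhds 0) (nhds (0, s')) := by
      have : Continuous (fun ε : ℝ => (ε * s, s')) := by fun_prop
      simpa using this.tendsto 0
    exact this hQ
  obtain ⟨ε, ⟨hεP, hεQ⟩, hε⟩ := (((h1.and h2).filter_mono nhdsWithin_le_nhds).and
    (Ioo_mem_nhdsGT (zero_lt_one' ℝ))).exists
  have hval : ∀ t : ℝ, AffineMap.lineMap (s, ε * s') (ε * s, s') t =
      (s * (1 - t + t * ε), s' * (ε * (1 - t) + t)) := by
    intro t
    rw [AffineMap.lineMap_apply_module]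
    ext <;> simp <;> ring
  refine ⟨AffineMap.lineMap (s, ε * s') (ε * s, s'), AffineMap.lineMap_continuous,
    AffineMap.lineMap_injective ℝ ?_, by simpa using hεP, by simpa using hεQ, ?_⟩
  · intro h
    have h := congrArg Prod.fst h
    simp only at h
    have : (1 - ε) * s = 0 := by linarith
    rcases mul_eq_zero.1 this with h | h
    · linarith [hε.2]
    · exact hs h
  · intro t ht
    rw [hval]
    have hε0 := hε.1
    refine ⟨mul_ne_zero hs (ne_of_gt ?_), mul_ne_zero hs' (ne_of_gt ?_)⟩
    · rcases eq_or_lt_of_le ht.1 with h | h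
      · rw [← h]; norm_num
      · nlinarith [ht.2]
    · rcases eq_or_lt_of_le ht.1 with h | h
      · rw [← h]; linarith
      · nlinarith [ht.2]

/-- If two edges of a 1-planar drawing cross, then an edge joining an endpoint of the first to an
endpoint of the second can be redrawn without crossings. -/
theorem Drawing.IsOnePlanar.exists_uncross {V : Type*} [Finite V] {G : SimpleGraph V}
    {D : Drawing G} (hD : D.IsOnePlanar) {R : ℝ} (hR : 0 < R) (hDR : D.IsStraightNear R)
    {e₁ e₂ e₃ : G.edgeSet} (hne : e₁ ≠ e₂) {c : ℝ × ℝ} (hc : c ∉ range D.pos)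
    (hc₁ : c ∈ D.arcIm e₁) (hc₂ : c ∈ D.arcIm e₂) {x z : V} (hx : x ∈ (e₁ : Sym2 V))
    (hz : z ∈ (e₂ : Sym2 V)) (he₃ : (e₃ : Sym2 V) = s(x, z)) :
    ∃ D' : Drawing G, D'.IsOnePlanar ∧ D'.crossings ⊆ {p ∈ D.crossings | p ∉ D.arcIm e₃} := by
  have hshare : ∀ v, v ∈ (e₁ : Sym2 V) → v ∉ (e₂ : Sym2 V) := fun v h1 h2 =>
    hc ⟨v, (D.shared_endpoint e₁ e₂ hne v h1 h2 ⟨hc₁, hc₂⟩).symm⟩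
  have hx3 : x ∈ (e₃ : Sym2 V) := by simp [he₃]
  have hz3 : z ∈ (e₃ : Sym2 V) := by simp [he₃]
  have h31 : e₃ ≠ e₁ := by rintro rfl; exact hshare z hz3 hz
  have h32 : e₃ ≠ e₂ := by rintro rfl; exact hshare x hx hx3
  obtain ⟨y, f, τ, he₁, hxy, hf, hfi, hf0, hf1, hfe, hτ1, hfτ, hfo, hfU⟩ :=
    hD.exists_param hne hc hc₁ hc₂ hx
  obtain ⟨y', k, τ', he₂, hzy, hk, hki, hk0, hk1, hke, hτ'1, hkτ, hko, hkU⟩ :=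
    hD.exists_param hne.symm hc hc₂ hc₁ hz
  have harc : ∀ e, e ≠ e₁ → e ≠ e₂ → c ∉ D.arcIm e := by
    intro e h1 h2 h
    rcases D.at_most_two c hc e e₁ e₂ h hc₁ hc₂ with h | h | h
    exacts [h1 h, h2 h, hne h]
  -- a standard neighbourhood of the crossing, avoiding everything else
  obtain ⟨ψ, hψ, hψ0, hψW, hψ₁, hψ₂⟩ : ∃ ψ : ℝ × ℝ → ℝ × ℝ, Topology.IsOpenEmbedding ψ ∧
      ψ 0 = c ∧ (∀ q, ψ q ∉ range D.pos ∧ ∀ e, e ≠ e₁ → e ≠ e₂ → ψ q ∉ D.arcIm e) ∧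
      (∀ q, ψ q ∈ D.arcIm e₁ ↔ q.2 = 0) ∧ ∀ q, ψ q ∈ D.arcIm e₂ ↔ q.1 = 0 := by
    have hW : ∀ᶠ q in nhds c, q ∉ range D.pos ∧ ∀ e, e ≠ e₁ → e ≠ e₂ → q ∉ D.arcIm e := by
      refine Filter.Eventually.and ((finite_range D.pos).isClosed.isOpen_compl.mem_nhds hc) ?_
      simp only [Filter.eventually_all]
      exact fun e h1 h2 => (D.isClosed_arcIm e).isOpen_compl.mem_nhds (harc e h1 h2)
    exact (D.proper e₁ e₂ hne c ⟨hc₁, hc₂⟩ hc).exists_small hW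
  have hψc : range ψ ∈ nhds c := hψ.isOpen_range.mem_nhds ⟨0, hψ0⟩
  obtain ⟨t₁, ht₁, ⟨⟨s, s₂⟩, hs⟩⟩ := hfU _ hψc
  obtain ⟨u₁, hu₁, ⟨⟨s₁, s'⟩, hs'⟩⟩ := hkU _ hψc
  have ht₁m : t₁ ∈ Icc (0 : ℝ) 1 := ⟨ht₁.1.le, (ht₁.2.trans hτ1).le⟩
  have hu₁m : u₁ ∈ Icc (0 : ℝ) 1 := ⟨hu₁.1.le, (hu₁.2.trans hτ'1).le⟩
  obtain rfl : s₂ = 0 := (hψ₁ (s, s₂)).1 (by rw [hs, ← hfe]; exact ⟨t₁, ht₁m, rfl⟩)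
  obtain rfl : s₁ = 0 := (hψ₂ (s₁, s')).1 (by rw [hs', ← hke]; exact ⟨u₁, hu₁m, rfl⟩)
  have hs0 : s ≠ 0 := by
    rintro rfl
    exact hfo e₂ hne.symm t₁ ht₁ (hs ▸ (hψ₂ _).2 rfl)
  have hs'0 : s' ≠ 0 := by
    rintro rfl
    exact hko e₁ hne u₁ hu₁ (hs' ▸ (hψ₁ _).2 rfl)
  -- disjoint neighbourhoods of the two initial segments
  have hsm : Icc 0 t₁ ⊆ Icc (0 : ℝ) 1 := Icc_subset_Icc_right ht₁m.2
  have hum : Icc 0 u₁ ⊆ Icc (0 : ℝ) 1 := Icc_subset_Icc_right hu₁m.2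
  obtain ⟨O, O', hO, hO', hfO, hkO, hOO⟩ : SeparatedNhds (f '' Icc 0 t₁) (k '' Icc 0 u₁) := by
    refine SeparatedNhds.of_isCompact_isCompact
      (isCompact_Icc.image_of_continuousOn (hf.mono hsm))
      (isCompact_Icc.image_of_continuousOn (hk.mono hum)) ?_
    rw [disjoint_left]
    rintro _ ⟨t, ht, rfl⟩ ⟨u, hu, hut⟩
    have hte : f t ∈ D.arcIm e₂ := by rw [← hut, ← hke]; exact ⟨u, hum hu, rfl⟩
    rcases eq_or_lt_of_le ht.1 with rfl | h0
    · rw [hf0] at hte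
      exact D.no_vertex_interior e₂ x (hshare x hx) hte
    · exact hfo e₂ hne.symm t ⟨h0, ht.2.trans_lt ht₁.2⟩ hte
  have hvopen : ∀ w, IsOpen (D.pos '' {v | v ≠ w})ᶜ := fun w =>
    (toFinite _).isClosed.isOpen_compl
  have hfv : ∀ t ∈ Icc 0 t₁, f t ∈ (D.pos '' {v | v ≠ x})ᶜ := by
    rintro t ht ⟨v, hv, hvt⟩
    have hv1 : v ∈ (e₁ : Sym2 V) := by
      by_contra h
      exact D.no_vertex_interior e₁ v h (by rw [hvt]; exact hfe.subset ⟨t, hsm ht, rfl⟩)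
    rw [he₁, Sym2.mem_iff] at hv1
    rcases hv1 with rfl | rfl
    · exact hv rfl
    · have := hfi (hsm ht) ⟨zero_le_one, le_rfl⟩ (hvt.symm.trans hf1.symm)
      linarith [ht.2, ht₁.2]
  have hkv : ∀ t ∈ Icc 0 u₁, k t ∈ (D.pos '' {v | v ≠ z})ᶜ := by
    rintro t ht ⟨v, hv, hvt⟩
    have hv1 : v ∈ (e₂ : Sym2 V) := by
      by_contra h
      exact D.no_vertex_interior e₂ v h (by rw [hvt]; exact hke.subset ⟨t, hum ht, rfl⟩)
    rw [he₂, Sym2.mem_iff] at hv1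
    rcases hv1 with rfl | rfl
    · exact hv rfl
    · have := hki (hum ht) ⟨zero_le_one, le_rfl⟩ (hvt.symm.trans hk1.symm)
      linarith [ht.2, hu₁.2]
  obtain ⟨P, hP, hxP, hfP, hPO, hPe⟩ := D.exists_isPod hR hDR hx hf hfi hf0 hfe ht₁.1 ht₁m.2
    (hO.inter (hvopen x)) (fun t ht => ⟨hfO ⟨t, ht, rfl⟩, hfv t ht⟩)
    (fun e he t ht => hfo e he t ⟨ht.1, ht.2.trans_lt ht₁.2⟩)
  obtain ⟨Q, hQ, hzQ, hkQ, hQO, hQe⟩ := D.exists_isPod hR hDR hz hk hki hk0 hke hu₁.1 hu₁m.2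
    (hO'.inter (hvopen z)) (fun t ht => ⟨hkO ⟨t, ht, rfl⟩, hkv t ht⟩)
    (fun e he t ht => hko e he t ⟨ht.1, ht.2.trans_lt hu₁.2⟩)
  have hPQ : ∀ q, q ∈ P → q ∉ Q := fun q hp hq =>
    disjoint_left.1 hOO (hPO hp).1 (hQO hq).1
  have hPv : ∀ v, D.pos v ∈ P → v = x := fun v hv => by
    by_contra h
    exact (hPO hv).2 ⟨v, h, rfl⟩
  have hQv : ∀ v, D.pos v ∈ Q → v = z := fun v hv => by
    by_contra h
    exact (hQO hv).2 ⟨v, h, rfl⟩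
  -- a path near the crossing from one pod to the other
  obtain ⟨g, hg, hgi, hg0, hg1, hgaxes⟩ := exists_segment_avoiding_axes (P := ψ ⁻¹' P)
    (Q := ψ ⁻¹' Q) hs0 hs'0
    (hψ.continuous.continuousAt (hs.symm ▸ mem_interior_iff_mem_nhds.1 hfP))
    (hψ.continuous.continuousAt (hs'.symm ▸ mem_interior_iff_mem_nhds.1 hkQ))
  set γ : ℝ → ℝ × ℝ := fun t => ψ (g t) with hγ
  have hγc : Continuous γ := hψ.continuous.comp hg
  have hγi : Function.Injective γ := hψ.injective.comp hgi
  have hγv : ∀ t, γ t ∉ range D.pos := fun t => (hψW _).1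
  have hγe : ∀ t ∈ Icc (0 : ℝ) 1, ∀ e, γ t ∉ D.arcIm e := by
    intro t ht e he
    by_cases h1 : e = e₁
    · exact (hgaxes t ht).2 ((hψ₁ _).1 (h1 ▸ he))
    by_cases h2 : e = e₂
    · exact (hgaxes t ht).1 ((hψ₂ _).1 (h2 ▸ he))
    exact (hψW _).2 e h1 h2 he
  obtain ⟨a, ha, haP, hamax⟩ := exists_last_time hγc.continuousOn hP.isClosed
    (show (0 : ℝ) ∈ Icc (0 : ℝ) 1 by simp) hg0
  obtain ⟨b, hb, hbQ, hbmin⟩ := exists_first_time (s := a) hγc.continuousOn hQ.isClosed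
    (right_mem_Icc.2 ha.2) hg1
  have hab : a < b := lt_of_le_of_ne hb.1 (by rintro rfl; exact hPQ _ haP hbQ)
  have hbm : b ∈ Icc (0 : ℝ) 1 := ⟨ha.1.trans hb.1, hb.2⟩
  have hM : Icc a b ⊆ Icc 0 1 := Icc_subset_Icc ha.1 hb.2
  have hMP : ∀ t ∈ Icc a b, γ t ∈ P → t = a := fun t ht h =>
    le_antisymm (hamax t (hM ht) h) ht.1
  have hMQ : ∀ t ∈ Icc a b, γ t ∈ Q → t = b := fun t ht h =>
    le_antisymm ht.2 (hbmin t ⟨ht.1, ht.2.trans hb.2⟩ h)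
  obtain ⟨A₁, B₁, hA₁, hB₁, hB₁P, hAB₁, hA₁s, hA₁l⟩ := hP.exists_reroute hf hfi hf0 ht₁.1 ht₁m.2
    (interior_subset hfP) (by rw [hf1]; exact fun h => hxy (hPv y h).symm) haP
    (fun h => hγv a ⟨x, h.symm⟩) (hfe ▸ hγe a ha e₁)
  obtain ⟨A₂, B₂, hA₂, hB₂, hB₂Q, hAB₂, hA₂s, hA₂l⟩ := hQ.exists_reroute hk hki hk0 hu₁.1 hu₁m.2
    (interior_subset hkQ) (by rw [hk1]; exact fun h => hzy (hQv y' h).symm) hbQ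
    (fun h => hγv b ⟨z, h.symm⟩) (hke ▸ hγe b hbm e₂)
  rw [hfe] at hA₁s hA₁l
  rw [hke] at hA₂s hA₂l
  rw [hf1] at hA₁
  rw [hk1] at hA₂
  have haB : γ a ∈ B₁ := by
    obtain ⟨g, -, -, h0, -, rfl⟩ := hB₁
    exact ⟨0, ⟨le_rfl, zero_le_one⟩, h0⟩
  have hbB : γ b ∈ B₂ := by
    obtain ⟨g, -, -, h0, -, rfl⟩ := hB₂
    exact ⟨0, ⟨le_rfl, zero_le_one⟩, h0⟩
  set A₃ : Set (ℝ × ℝ) := B₁ ∪ γ '' Icc a b ∪ B₂ with hA₃def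
  have hA₃ : IsArc A₃ (D.pos x) (D.pos z) := by
    refine (hB₁.symm.union (isArc_image_Icc hab hγc.continuousOn hγi.injOn) ?_).union hB₂ ?_
    · rintro _ ⟨hp, t, ht, rfl⟩
      rw [hMP t ht (hB₁P hp)]; rfl
    · rintro p ⟨hp | ⟨t, ht, rfl⟩, hq⟩
      · exact (hPQ p (hB₁P hp) (hB₂Q hq)).elim
      · rw [hMQ t ht (hB₂Q hq)]; rfl
  -- intersections of the new arcs
  have hnP : ∀ p ∉ range D.pos, p ∈ P → ∀ e, e ≠ e₁ → p ∉ D.arcIm e := fun p hp h e he h' =>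
    hp ⟨x, (hPe e he ⟨h, h'⟩).symm⟩
  have hnQ : ∀ p ∉ range D.pos, p ∈ Q → ∀ e, e ≠ e₂ → p ∉ D.arcIm e := fun p hp h e he h' =>
    hp ⟨z, (hQe e he ⟨h, h'⟩).symm⟩
  have h12 : ∀ p ∉ range D.pos, p ∈ A₁ → p ∈ A₂ → p ∉ P ∧ p ∉ Q := by
    intro p hp h1 h2
    constructor
    · intro h
      rcases hA₂s h2 with h' | h'
      · exact hPQ p h h'
      · exact hnP p hp h e₂ hne.symm h'
    · intro h
      rcases hA₁s h1 with h' | h'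
      · exact hPQ p h' h
      · exact hnQ p hp h e₁ hne h'
  have h13 : ∀ p ∉ range D.pos, p ∈ A₁ → p ∉ A₃ := by
    rintro p hp h1 ((h | ⟨t, ht, rfl⟩) | h)
    · exact hp ⟨x, (hAB₁ ⟨h1, h⟩).symm⟩
    · rcases hA₁s h1 with h' | h'
      · have hta := hMP t ht h'
        rw [hta] at h1 hp
        exact hp ⟨x, (hAB₁ ⟨h1, haB⟩).symm⟩
      · exact hγe t (hM ht) e₁ h'
    · rcases hA₁s h1 with h' | h'
      · exact hPQ p h' (hB₂Q h)
      · exact hnQ p hp (hB₂Q h) e₁ hne h'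
  have h23 : ∀ p ∉ range D.pos, p ∈ A₂ → p ∉ A₃ := by
    rintro p hp h1 ((h | ⟨t, ht, rfl⟩) | h)
    · rcases hA₂s h1 with h' | h'
      · exact hPQ p (hB₁P h) h'
      · exact hnP p hp (hB₁P h) e₂ hne.symm h'
    · rcases hA₂s h1 with h' | h'
      · have htb := hMQ t ht h'
        rw [htb] at h1 hp
        exact hp ⟨z, (hAB₂ ⟨h1, hbB⟩).symm⟩
      · exact hγe t (hM ht) e₂ h'
    · exact hp ⟨z, (hAB₂ ⟨h1, h⟩).symm⟩
  have h1o : ∀ e, e ≠ e₁ → e ≠ e₂ → ∀ p ∉ range D.pos, p ∈ A₁ → p ∉ D.arcIm e := by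
    intro e n1 n2 p hp h1 h
    rcases hA₁s h1 with h' | h'
    · exact hnP p hp h' e n1 h
    · have := hD e₁ ⟨⟨hp, e, e₁, n1, h, h'⟩, h'⟩ ⟨⟨hc, e₁, e₂, hne, hc₁, hc₂⟩, hc₁⟩
      exact harc e n1 n2 (this ▸ h)
  have h2o : ∀ e, e ≠ e₁ → e ≠ e₂ → ∀ p ∉ range D.pos, p ∈ A₂ → p ∉ D.arcIm e := by
    intro e n1 n2 p hp h1 h
    rcases hA₂s h1 with h' | h'
    · exact hnQ p hp h' e n2 h
    · have := hD e₂ ⟨⟨hp, e, e₂, n2, h, h'⟩, h'⟩ ⟨⟨hc, e₁, e₂, hne, hc₁, hc₂⟩, hc₂⟩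
      exact harc e n1 n2 (this ▸ h)
  have h3o : ∀ e, e ≠ e₁ → e ≠ e₂ → ∀ p ∉ range D.pos, p ∈ A₃ → p ∉ D.arcIm e := by
    rintro e n1 n2 p hp ((h | ⟨t, ht, rfl⟩) | h)
    · exact hnP p hp (hB₁P h) e n1
    · exact hγe t (hM ht) e
    · exact hnQ p hp (hB₂Q h) e n2
  classical
  set A : G.edgeSet → Set (ℝ × ℝ) := fun e =>
    if e = e₁ then A₁ else if e = e₂ then A₂ else if e = e₃ then A₃ else D.arcIm e with hAdef
  have hAe₁ : A e₁ = A₁ := by simp [hAdef]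
  have hAe₂ : A e₂ = A₂ := by simp [hAdef, hne.symm]
  have hAe₃ : A e₃ = A₃ := by simp [hAdef, h31, h32]
  have hAo : ∀ e, e ≠ e₁ → e ≠ e₂ → e ≠ e₃ → A e = D.arcIm e := by
    intro e n1 n2 n3
    simp [hAdef, n1, n2, n3]
  have hcases : ∀ e, e = e₁ ∨ e = e₂ ∨ e = e₃ ∨ (e ≠ e₁ ∧ e ≠ e₂ ∧ e ≠ e₃) := by
    intro e; tauto
  have hcross : ∀ e e' : G.edgeSet, e ≠ e' → ∀ p ∈ A e ∩ A e', p ∉ range D.pos →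
      (e ≠ e₃ ∧ e' ≠ e₃) ∧ p ∈ D.arcIm e ∧ p ∈ D.arcIm e' ∧
      (∀ᶠ q in nhds p, q ∈ A e ↔ q ∈ D.arcIm e) ∧ ∀ᶠ q in nhds p, q ∈ A e' ↔ q ∈ D.arcIm e' := by
    have hsymm : ∀ p ∉ range D.pos, p ∈ A₁ → p ∈ A₂ → p ∈ D.arcIm e₁ ∧ p ∈ D.arcIm e₂ ∧
        (∀ᶠ q in nhds p, q ∈ A₁ ↔ q ∈ D.arcIm e₁) ∧ ∀ᶠ q in nhds p, q ∈ A₂ ↔ q ∈ D.arcIm e₂ := by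
      intro p hr h1 h2
      obtain ⟨g1, g2⟩ := h12 p hr h1 h2
      have l1 := hA₁l p h1 g1
      have l2 := hA₂l p h2 g2
      exact ⟨l1.self_of_nhds.1 h1, l2.self_of_nhds.1 h2, l1, l2⟩
    rintro e e' hee p ⟨hp, hp'⟩ hr
    rcases hcases e with rfl | rfl | rfl | ⟨n1, n2, n3⟩ <;>
      rcases hcases e' with rfl | rfl | rfl | ⟨n1', n2', n3'⟩ <;>
      first
      | exact absurd rfl hee
      | skip
    · rw [hAe₁] at hp ⊢
      rw [hAe₂] at hp' ⊢
      exact ⟨⟨h31.symm, h32.symm⟩, hsymm p hr hp hp'⟩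
    · exact (h13 p hr (hAe₁ ▸ hp) (hAe₃ ▸ hp')).elim
    · exact (h1o _ n1' n2' p hr (hAe₁ ▸ hp) (hAo _ n1' n2' n3' ▸ hp')).elim
    · rw [hAe₂] at hp ⊢
      rw [hAe₁] at hp' ⊢
      obtain ⟨l1, l2, l3, l4⟩ := hsymm p hr hp' hp
      exact ⟨⟨h32.symm, h31.symm⟩, l2, l1, l4, l3⟩
    · exact (h23 p hr (hAe₂ ▸ hp) (hAe₃ ▸ hp')).elim
    · exact (h2o _ n1' n2' p hr (hAe₂ ▸ hp) (hAo _ n1' n2' n3' ▸ hp')).elim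
    · exact (h13 p hr (hAe₁ ▸ hp') (hAe₃ ▸ hp)).elim
    · exact (h23 p hr (hAe₂ ▸ hp') (hAe₃ ▸ hp)).elim
    · exact (h3o _ n1' n2' p hr (hAe₃ ▸ hp) (hAo _ n1' n2' n3' ▸ hp')).elim
    · exact (h1o _ n1 n2 p hr (hAe₁ ▸ hp') (hAo _ n1 n2 n3 ▸ hp)).elim
    · exact (h2o _ n1 n2 p hr (hAe₂ ▸ hp') (hAo _ n1 n2 n3 ▸ hp)).elim
    · exact (h3o _ n1 n2 p hr (hAe₃ ▸ hp') (hAo _ n1 n2 n3 ▸ hp)).elim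
    · rw [hAo _ n1 n2 n3] at hp ⊢
      rw [hAo _ n1' n2' n3'] at hp' ⊢
      exact ⟨⟨n3, n3'⟩, hp, hp', Filter.Eventually.of_forall fun _ => Iff.rfl,
        Filter.Eventually.of_forall fun _ => Iff.rfl⟩
  have hvert : ∀ (e : G.edgeSet) (v : V), v ∉ (e : Sym2 V) → D.pos v ∉ A e := by
    intro e v hv hve
    rcases hcases e with rfl | rfl | rfl | ⟨n1, n2, n3⟩
    · rw [hAe₁] at hve
      rcases hA₁s hve with h | h
      · exact hv (hPv v h ▸ hx)
      · exact D.no_vertex_interior _ v hv h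
    · rw [hAe₂] at hve
      rcases hA₂s hve with h | h
      · exact hv (hQv v h ▸ hz)
      · exact D.no_vertex_interior _ v hv h
    · rw [hAe₃] at hve
      rcases hve with (h | ⟨t, ht, h⟩) | h
      · exact hv (hPv v (hB₁P h) ▸ hx3)
      · exact hγv t ⟨v, h.symm⟩
      · exact hv (hQv v (hB₂Q h) ▸ hz3)
    · rw [hAo _ n1 n2 n3] at hve
      exact D.no_vertex_interior _ v hv hve
  have hends : ∀ e : G.edgeSet, ∃ u v : V, (e : Sym2 V) = s(u, v) ∧
      IsArc (A e) (D.pos u) (D.pos v) := by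
    intro e
    rcases hcases e with rfl | rfl | rfl | ⟨n1, n2, n3⟩
    · exact ⟨x, y, he₁, hAe₁ ▸ hA₁⟩
    · exact ⟨z, y', he₂, hAe₂ ▸ hA₂⟩
    · exact ⟨x, z, he₃, hAe₃ ▸ hA₃⟩
    · rw [hAo _ n1 n2 n3]
      obtain ⟨u, v, he, h0, h1⟩ := D.arc_ends e
      exact ⟨u, v, he, D.arc e, D.arc_cont e, D.arc_inj e, h0, h1, rfl⟩
  obtain ⟨D', hD', hpos, harc', hsub⟩ := D.exists_redraw hD A hends hvert
    fun e e' hee p hp hr => (hcross e e' hee p hp hr).2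
  refine ⟨D', hD', fun p hp => ⟨hsub hp, fun hp3 => ?_⟩⟩
  obtain ⟨hr, e, e', hee, h, h'⟩ := hp
  rw [hpos] at hr
  rw [harc'] at h h'
  obtain ⟨⟨n, n'⟩, k1, k2, -⟩ := hcross e e' hee p ⟨h, h'⟩ hr
  rcases D.at_most_two p hr e e' e₃ k1 k2 hp3 with h | h | h
  exacts [hee h, n h, n' h]

theorem Drawing.finite_crossings {V : Type*} [Finite V] {G : SimpleGraph V} (D : Drawing G) :
    D.crossings.Finite := by
  have : (⋃ e : {e : G.edgeSet × G.edgeSet // e.1 ≠ e.2}, D.arcIm e.1.1 ∩ D.arcIm e.1.2).Finite :=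
    finite_iUnion fun e => D.finite_meet _ _ e.2
  refine this.subset ?_
  rintro p ⟨-, e₁, e₂, hne, h1, h2⟩
  exact mem_iUnion.2 ⟨⟨(e₁, e₂), hne⟩, h1, h2⟩

/-- In a 1-planar drawing of a 1-planar graph `G` with the minimum
number of crossings among all 1-planar drawings of `G`, any two distinct
crossings have cluster sets sharing at most two vertices. -/
theorem stmt0 {V : Type*} [Fintype V] (G : SimpleGraph V)
    (hG : G.OnePlanar) (D : Drawing G) (hD : D.IsOnePlanar)
    (hmin : ∀ D' : Drawing G, D'.IsOnePlanar → D.crossingCount ≤ D'.crossingCount) :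
    ∀ c₁ ∈ D.crossings, ∀ c₂ ∈ D.crossings, c₁ ≠ c₂ →
      (D.cluster c₁ ∩ D.cluster c₂).ncard ≤ 2 := by
  intro c₁ hc₁ c₂ hc₂ hne
  by_contra! hcard
  obtain ⟨D₀, hD₀, hsub, hinc, R, hR, hstr⟩ := D.exists_isStraightNear hD
  have hcr : D₀.crossings = D.crossings :=
    eq_of_subset_of_ncard_le hsub (hmin D₀ hD₀) D.finite_crossings
  rw [← hcr] at hc₁ hc₂
  have hcluster : ∀ c ∈ D₀.crossings, ∀ e₁ e₂, e₁ ≠ e₂ → c ∈ D₀.arcIm e₁ → c ∈ D₀.arcIm e₂ →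
      ∀ v ∈ D.cluster c, v ∈ (e₁ : Sym2 V) ∨ v ∈ (e₂ : Sym2 V) := by
    rintro c hc e₁ e₂ h12 h1 h2 v ⟨e, he, hv⟩
    rcases D.at_most_two c (hsub hc).1 e e₁ e₂ he (hinc c hc e₁ h1) (hinc c hc e₂ h2) with h | h | h
    · exact Or.inl (h ▸ hv)
    · exact Or.inr (h ▸ hv)
    · exact (h12 h).elim
  obtain ⟨hr, e₁, e₂, h12, h1, h2⟩ := id hc₁
  obtain ⟨-, e₃, e₄, h34, h3, h4⟩ := id hc₂
  have hremove : ∀ D' : Drawing G, D'.IsOnePlanar → ∀ e, c₂ ∈ D₀.arcIm e →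
      ¬ D'.crossings ⊆ {p ∈ D₀.crossings | p ∉ D₀.arcIm e} := by
    intro D' hD' e he hs
    have hlt : D'.crossings.ncard < D.crossings.ncard := by
      refine ncard_lt_ncard ⟨fun p hp => hsub (hs hp).1, fun h => ?_⟩ D.finite_crossings
      exact (hs (h (hsub hc₂))).2 he
    exact absurd (hmin D' hD') (not_le.2 hlt)
  have key : ∀ e, c₂ ∈ D₀.arcIm e → ∀ u w : V, u ≠ w → u ∈ (e : Sym2 V) → w ∈ (e : Sym2 V) →
      u ∈ D.cluster c₁ → w ∈ D.cluster c₁ → False := by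
    intro e he u w huw hue hwe hu hw
    have hnot : ∀ e', c₁ ∈ D₀.arcIm e' → u ∈ (e' : Sym2 V) → w ∉ (e' : Sym2 V) := by
      intro e' he' hu' hw'
      have hee : e = e' := Subtype.ext
        (((Sym2.mem_and_mem_iff huw).1 ⟨hue, hwe⟩).trans
          ((Sym2.mem_and_mem_iff huw).1 ⟨hu', hw'⟩).symm)
      exact hne (hD₀ e' ⟨hc₁, he'⟩ ⟨hc₂, hee ▸ he⟩)
    have he3 := (Sym2.mem_and_mem_iff huw).1 ⟨hue, hwe⟩
    rcases hcluster c₁ hc₁ e₁ e₂ h12 h1 h2 u hu with hu' | hu' <;>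
      rcases hcluster c₁ hc₁ e₁ e₂ h12 h1 h2 w hw with hw' | hw'
    · exact hnot e₁ h1 hu' hw'
    · obtain ⟨D', hD', hs⟩ := hD₀.exists_uncross hR hstr h12 hr h1 h2 hu' hw' he3
      exact hremove D' hD' e he hs
    · obtain ⟨D', hD', hs⟩ := hD₀.exists_uncross hR hstr h12.symm hr h2 h1 hu' hw' he3
      exact hremove D' hD' e he hs
    · exact hnot e₂ h2 hu' hw'
  obtain ⟨a, b, d, ha, hb, hd, hab, had, hbd⟩ := (two_lt_ncard_iff (toFinite _)).1 hcard
  have hcl := hcluster c₂ hc₂ e₃ e₄ h34 h3 h4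
  rcases hcl a ha.2 with ha' | ha' <;> rcases hcl b hb.2 with hb' | hb' <;>
    rcases hcl d hd.2 with hd' | hd'
  · exact key e₃ h3 a b hab ha' hb' ha.1 hb.1
  · exact key e₃ h3 a b hab ha' hb' ha.1 hb.1
  · exact key e₃ h3 a d had ha' hd' ha.1 hd.1
  · exact key e₄ h4 b d hbd hb' hd' hb.1 hd.1
  · exact key e₃ h3 b d hbd hb' hd' hb.1 hd.1
  · exact key e₄ h4 a d had ha' hd' ha.1 hd.1
  · exact key e₄ h4 a b hab ha' hb' ha.1 hb.1
  · exact key e₄ h4 a b hab ha' hb' ha.1 hb.1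
end

section
/- Every NIC-planar graph G with at least 2 vertices satisfies cr(G) ≤ (3/5)(v(G) − 2), i.e. 5·cr(G) ≤ 3·(v(G) − 2), where v(G) is the number of vertices of G. -/
open Set

/-- `δ` is the total change of a continuous logarithm of `f` over the unit interval. -/
def HasLogIncrement (f : ℝ → ℂ) (δ : ℂ) : Prop :=
  ∃ l : ℝ → ℂ, Continuous l ∧ (∀ s, Complex.exp (l s) = f s) ∧ l 1 - l 0 = δ

theorem exists_continuous_log {X : Type*} [TopologicalSpace X] [SimplyConnectedSpace X]
    [LocallyPathConnectedSpace X] {f : X → ℂ} (hf : Continuous f) (h0 : ∀ x, f x ≠ 0) :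
    ∃ l : X → ℂ, Continuous l ∧ ∀ x, Complex.exp (l x) = f x := by
  obtain ⟨x₀⟩ := (inferInstance : Nonempty X)
  obtain ⟨F, ⟨-, hF⟩, -⟩ := Complex.isCoveringMap_exp.existsUnique_continuousMap_lifts
    (⟨fun x => ⟨f x, h0 x⟩, by fun_prop⟩ : C(X, {z : ℂ // z ≠ 0})) x₀ (Complex.log (f x₀))
    (Subtype.ext (Complex.exp_log (h0 x₀)))
  exact ⟨F, F.continuous, fun x => congrArg Subtype.val (congrFun hF x)⟩

theorem HasLogIncrement.unique {f : ℝ → ℂ} {δ δ' : ℂ} (h : HasLogIncrement f δ)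
    (h' : HasLogIncrement f δ') : δ = δ' := by
  obtain ⟨l, hl, hlf, rfl⟩ := h
  obtain ⟨m, hm, hmf, rfl⟩ := h'
  have key : l = fun s => m s + (l 0 - m 0) := by
    refine Complex.isCoveringMap_exp.eq_of_comp_eq hl (by fun_prop) ?_ 0 (by simp)
    funext s
    refine Subtype.ext ?_
    simp [Complex.exp_add, Complex.exp_sub, hlf, hmf]
    rw [div_self, mul_one]
    rw [← hlf]; exact Complex.exp_ne_zero _
  rw [congrFun key 1]
  ring

theorem exists_hasLogIncrement {f : ℝ → ℂ} (hf : Continuous f) (h0 : ∀ x, f x ≠ 0) :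
    ∃ δ, HasLogIncrement f δ := by
  obtain ⟨l, hl, hlf⟩ := exists_continuous_log hf h0
  exact ⟨_, l, hl, hlf, rfl⟩

theorem HasLogIncrement.neg {f : ℝ → ℂ} {δ : ℂ} (h : HasLogIncrement f δ) :
    HasLogIncrement (fun s => -f s) δ := by
  obtain ⟨l, hl, hlf, rfl⟩ := h
  exact ⟨fun s => l s + Real.pi * Complex.I, by fun_prop,
    fun s => by simp [Complex.exp_add, hlf], by ring⟩

theorem HasLogIncrement.exp_eq {f : ℝ → ℂ} {δ : ℂ} (h : HasLogIncrement f δ) :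
    Complex.exp δ = f 1 / f 0 := by
  obtain ⟨l, hl, hlf, rfl⟩ := h
  rw [Complex.exp_sub, hlf, hlf]

/-- The logarithmic increments of the difference of two disjoint paths around the boundary of the
parameter square add up to zero. -/
theorem logIncrement_square {p q : ℝ → ℂ} (hp : Continuous p) (hq : Continuous q)
    (hpq : ∀ s t, p s ≠ q t) {a b c d : ℂ}
    (ha : HasLogIncrement (fun s => p s - q 0) a) (hb : HasLogIncrement (fun t => q t - p 1) b)
    (hc : HasLogIncrement (fun s => p s - q 1) c) (hd : HasLogIncrement (fun t => q t - p 0) d) :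
    a + b = c + d := by
  obtain ⟨l, hl, hlf⟩ := exists_continuous_log (X := ℝ × ℝ) (f := fun x => p x.1 - q x.2)
    (by fun_prop) (fun x => sub_ne_zero.2 (hpq _ _))
  have ha' : a = l (1, 0) - l (0, 0) :=
    ha.unique ⟨fun s => l (s, 0), by fun_prop, fun s => hlf _, rfl⟩
  have hc' : c = l (1, 1) - l (0, 1) :=
    hc.unique ⟨fun s => l (s, 1), by fun_prop, fun s => hlf _, rfl⟩
  have hb' : b = l (1, 1) - l (1, 0) :=
    hb.neg.unique ⟨fun t => l (1, t), by fun_prop, fun s => by simp [hlf], rfl⟩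
  have hd' : d = l (0, 1) - l (0, 0) :=
    hd.neg.unique ⟨fun t => l (0, t), by fun_prop, fun s => by simp [hlf], rfl⟩
  rw [ha', hb', hc', hd']
  ring

/-- A version of the van Kampen–Flores theorem: every drawing of `K₅` by continuous paths
has two disjoint edges whose paths meet. -/
theorem vanKampenFlores_paths (r : Fin 5 → ℂ) (γ : Fin 5 → Fin 5 → ℝ → ℂ)
    (hc : ∀ i j, i < j → Continuous (γ i j))
    (h0 : ∀ i j, i < j → γ i j 0 = r i) (h1 : ∀ i j, i < j → γ i j 1 = r j)
    (hd : ∀ i j k l, i < j → k < l → i ≠ k → i ≠ l → j ≠ k → j ≠ l →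
      ∀ s t, γ i j s ≠ γ k l t) : False := by
  have hvert : ∀ v i j, i < j → v ≠ i → v ≠ j → ∀ s, γ i j s - r v ≠ 0 := by
    intro v i j hij hvi hvj s
    obtain ⟨w, hwv, hwi, hwj⟩ : ∃ w : Fin 5, w ≠ v ∧ w ≠ i ∧ w ≠ j := by
      clear hc h0 h1 hd hij hvi hvj
      revert v i j; decide
    rcases lt_or_gt_of_ne hwv with h | h
    · rw [sub_ne_zero, ← h1 w v h]
      exact hd _ _ _ _ hij h hwi.symm hvi.symm hwj.symm hvj.symm _ _
    · rw [sub_ne_zero, ← h0 v w h]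
      exact hd _ _ _ _ hij h hvi.symm hwi.symm hvj.symm hwj.symm _ _
  have hr : ∀ i j, i ≠ j → r i - r j ≠ 0 := by
    intro i j hij
    obtain ⟨k, hki, hkj⟩ : ∃ w : Fin 5, w ≠ i ∧ w ≠ j := by
      clear hvert hc h0 h1 hd hij
      revert i j; decide
    rcases lt_or_gt_of_ne hki with h | h
    · have := hvert j k i h hkj.symm hij.symm 1
      rwa [h1 _ _ h] at this
    · have := hvert j i k h hij.symm hkj.symm 0
      rwa [h0 _ _ h] at this
  -- a logarithm of `r j - r i`, antisymmetric up to half a turn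
  obtain ⟨m, hm⟩ : ∃ m : Fin 5 → Fin 5 → ℂ, ∀ i j, i < j →
      Complex.exp (m i j) = r j - r i :=
    ⟨fun i j => Complex.log (r j - r i), fun i j hij => Complex.exp_log (hr _ _ hij.ne')⟩
  let ε : Fin 5 → Fin 5 → ℤ := fun i j => if i < j then 0 else 1
  let L : Fin 5 → Fin 5 → ℂ := fun i j => m (min i j) (max i j) + ε i j * (Real.pi * Complex.I)
  have hL : ∀ i j, i ≠ j → Complex.exp (L i j) = r j - r i := by
    intro i j hij
    rcases lt_or_gt_of_ne hij with h | h
    · simp [L, ε, h, h.le, hm]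
    · simp [L, ε, h, h.le, h.not_gt, Complex.exp_add, hm]
  have hinc : ∀ v i j, ∃ n : ℤ, (i < j → v ≠ i → v ≠ j →
      HasLogIncrement (fun s => γ i j s - r v)
        (L v j - L v i + n * (2 * Real.pi * Complex.I))) := by
    intro v i j
    by_cases h : i < j ∧ v ≠ i ∧ v ≠ j
    · obtain ⟨hij, hvi, hvj⟩ := h
      obtain ⟨δ, hδ⟩ := exists_hasLogIncrement
        (f := fun s => γ i j s - r v) ((hc i j hij).sub continuous_const) (hvert v i j hij hvi hvj)
      have := hδ.exp_eq
      rw [h0 _ _ hij, h1 _ _ hij, ← hL v j hvj, ← hL v i hvi, ← Complex.exp_sub,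
        Complex.exp_eq_exp_iff_exists_int] at this
      obtain ⟨n, rfl⟩ := this
      exact ⟨n, fun _ _ _ => hδ⟩
    · exact ⟨0, fun a b c => (h ⟨a, b, c⟩).elim⟩
  choose n hn using hinc
  have key : ∀ i j k l, i < j → k < l → i ≠ k → i ≠ l → j ≠ k → j ≠ l →
      n k i j + n j k l - n l i j - n i k l + (ε k j + ε i k + ε j l + ε l i - 2) = 0 := by
    intro i j k l hij hkl hik hil hjk hjl
    have h := logIncrement_square (hc i j hij) (hc k l hkl)
      (hd i j k l hij hkl hik hil hjk hjl)
      (by rw [h0 _ _ hkl]; exact hn k i j hij hik.symm hjk.symm)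
      (by rw [h1 _ _ hij]; exact hn j k l hkl hjk hjl)
      (by rw [h1 _ _ hkl]; exact hn l i j hij hil.symm hjl.symm)
      (by rw [h0 _ _ hij]; exact hn i k l hkl hik hil)
    have hε : ∀ x y, x ≠ y → ε x y + ε y x = 1 := by
      intro x y hxy
      rcases lt_or_gt_of_ne hxy with h | h <;> simp [ε, h, h.not_gt]
    have e1 : (ε k j + ε j k : ℂ) = 1 := mod_cast hε k j hjk.symm
    have e2 : (ε i k + ε k i : ℂ) = 1 := mod_cast hε i k hik
    have e3 : (ε j l + ε l j : ℂ) = 1 := mod_cast hε j l hjl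
    have e4 : (ε l i + ε i l : ℂ) = 1 := mod_cast hε l i hil.symm
    simp only [L, min_comm j k, max_comm j k, min_comm i k, max_comm i k, min_comm l j,
      max_comm l j, min_comm l i, max_comm l i] at h
    have hz : ((n k i j + n j k l - n l i j - n i k l + (ε k j + ε i k + ε j l + ε l i - 2) : ℤ) :
        ℂ) * (2 * Real.pi * Complex.I) = 0 := by
      push_cast
      linear_combination h + (Real.pi * Complex.I) * (e1 + e2 + e3 + e4)
    exact_mod_cast (mul_eq_zero.1 hz).resolve_right Complex.two_pi_I_ne_zero
  have k1 := key 0 1 2 3 (by decide) (by decide) (by decide) (by decide) (by decide) (by decide)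
  have k2 := key 0 2 1 3 (by decide) (by decide) (by decide) (by decide) (by decide) (by decide)
  have k3 := key 0 3 1 2 (by decide) (by decide) (by decide) (by decide) (by decide) (by decide)
  have k4 := key 0 1 2 4 (by decide) (by decide) (by decide) (by decide) (by decide) (by decide)
  have k5 := key 0 2 1 4 (by decide) (by decide) (by decide) (by decide) (by decide) (by decide)
  have k6 := key 0 4 1 2 (by decide) (by decide) (by decide) (by decide) (by decide) (by decide)
  have k7 := key 0 1 3 4 (by decide) (by decide) (by decide) (by decide) (by decide) (by decide)
  have k8 := key 0 3 1 4 (by decide) (by decide) (by decide) (by decide) (by decide) (by decide)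
  have k9 := key 0 4 1 3 (by decide) (by decide) (by decide) (by decide) (by decide) (by decide)
  have k10 := key 0 2 3 4 (by decide) (by decide) (by decide) (by decide) (by decide) (by decide)
  have k11 := key 0 3 2 4 (by decide) (by decide) (by decide) (by decide) (by decide) (by decide)
  have k12 := key 0 4 2 3 (by decide) (by decide) (by decide) (by decide) (by decide) (by decide)
  have k13 := key 1 2 3 4 (by decide) (by decide) (by decide) (by decide) (by decide) (by decide)
  have k14 := key 1 3 2 4 (by decide) (by decide) (by decide) (by decide) (by decide) (by decide)
  have k15 := key 1 4 2 3 (by decide) (by decide) (by decide) (by decide) (by decide) (by decide)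
  simp [ε] at k1 k2 k3 k4 k5 k6 k7 k8 k9 k10 k11 k12 k13 k14 k15
  omega

/-- `G` admits an almost embedding into the plane: every edge is represented by a set joining the
points of its endpoints in such a way that disjoint edges get disjoint sets. -/
def AlmostPlanar {V : Type*} (G : SimpleGraph V) : Prop :=
  ∃ (r : V → ℝ × ℝ) (S : V → V → Set (ℝ × ℝ)),
    (∀ u v, G.Adj u v → JoinedIn (S u v) (r u) (r v)) ∧
    ∀ u v x y, G.Adj u v → G.Adj x y → u ≠ x → u ≠ y → v ≠ x → v ≠ y →
      Disjoint (S u v) (S x y)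

namespace AlmostPlanar

variable {V : Type*} {G H : SimpleGraph V}

theorem mono (h : G ≤ H) : AlmostPlanar H → AlmostPlanar G := by
  rintro ⟨r, S, hj, hd⟩
  exact ⟨r, S, fun u v huv => hj u v (h huv), fun u v x y huv hxy => hd u v x y (h huv) (h hxy)⟩

theorem not_complete_five (hG : AlmostPlanar G) (f : Fin 5 → V)
    (hadj : ∀ i j, i < j → G.Adj (f i) (f j)) : False := by
  have hf : Function.Injective f := by
    intro i j hij
    by_contra hne
    rcases lt_or_gt_of_ne hne with h | h
    exacts [(hadj i j h).ne hij, (hadj j i h).ne hij.symm]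
  obtain ⟨r, S, hj, hd⟩ := hG
  have hJ : ∀ i j, ∃ γ : ℝ → ℝ × ℝ, i < j → Continuous γ ∧ γ 0 = r (f i) ∧ γ 1 = r (f j) ∧
      ∀ t, γ t ∈ S (f i) (f j) := by
    intro i j
    by_cases hij : i < j
    · have h := hj _ _ (hadj i j hij)
      refine ⟨h.somePath.extend, fun _ => ⟨h.somePath.continuous_extend, by simp, by simp,
        fun t => ?_⟩⟩
      have : h.somePath.extend t ∈ range h.somePath := by
        rw [← Path.extend_range]; exact mem_range_self t
      obtain ⟨s, hs⟩ := this
      rw [← hs]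
      exact h.somePath_mem s
    · exact ⟨fun _ => 0, fun h => (hij h).elim⟩
  choose γ hγ using hJ
  let e := Complex.equivRealProdCLM.symm
  refine vanKampenFlores_paths (fun i => e (r (f i))) (fun i j t => e (γ i j t))
    (fun i j h => e.continuous.comp (hγ i j h).1) (fun i j h => by rw [(hγ i j h).2.1])
    (fun i j h => by rw [(hγ i j h).2.2.1]) ?_
  intro i j k l hij hkl hik hil hjk hjl s t hst
  refine Set.disjoint_left.1 (hd _ _ _ _ (hadj i j hij) (hadj k l hkl) (hf.ne hik) (hf.ne hil)
    (hf.ne hjk) (hf.ne hjl)) ((hγ i j hij).2.2.2 s) ?_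
  rw [e.injective hst]
  exact (hγ k l hkl).2.2.2 t

/-- The graph obtained by contracting the edge `uv` into `u`, leaving `v` isolated. -/
def _root_.SimpleGraph.contractInto (G : SimpleGraph V) (u v : V) : SimpleGraph V where
  Adj x y := x ≠ y ∧ x ≠ v ∧ y ≠ v ∧ (G.Adj x y ∨ (x = u ∧ G.Adj v y) ∨ (y = u ∧ G.Adj x v))
  symm := ⟨by
    rintro x y ⟨hxy, hx, hy, h⟩
    refine ⟨hxy.symm, hy, hx, ?_⟩
    rcases h with h | ⟨h, h'⟩ | ⟨h, h'⟩
    exacts [.inl h.symm, .inr (.inr ⟨h, h'.symm⟩), .inr (.inl ⟨h, h'.symm⟩)]⟩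
  loopless := ⟨fun x h => h.1 rfl⟩

theorem contractInto (hG : AlmostPlanar G) {u v : V} (huv : G.Adj u v) :
    AlmostPlanar (G.contractInto u v) := by
  classical
  obtain ⟨r, S, hj, hd⟩ := hG
  refine ⟨r, fun x y => if G.Adj x y then S x y else if x = u then S u v ∪ S v y
    else S x v ∪ S v u, ?_, ?_⟩
  · rintro x y ⟨hxy, hx, hy, h⟩
    by_cases hadj : G.Adj x y
    · simpa [hadj] using hj x y hadj
    · rcases h with h | ⟨rfl, h⟩ | ⟨rfl, h⟩
      · exact (hadj h).elim
      · simpa [hadj] using ((hj _ _ huv).mono subset_union_left).trans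
          ((hj _ _ h).mono subset_union_right)
      · simpa [hadj, hxy] using ((hj _ _ h).mono subset_union_left).trans
          ((hj _ _ huv.symm).mono subset_union_right)
  · rintro x y w z ⟨hxy, hx, hy, h⟩ ⟨hwz, hw, hz, h'⟩ hxw hxz hyw hyz
    have key : ∀ x y w z, x ≠ y → x ≠ v → y ≠ v →
        (G.Adj x y ∨ (x = u ∧ G.Adj v y) ∨ (y = u ∧ G.Adj x v)) → G.Adj w z → w ≠ v → z ≠ v →
        x ≠ w → x ≠ z → y ≠ w → y ≠ z →
        Disjoint (if G.Adj x y then S x y else if x = u then S u v ∪ S v y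
          else S x v ∪ S v u) (S w z) := by
      intro x y w z hxy hx hy h hwz hw hz hxw hxz hyw hyz
      split_ifs with h1 h2
      · exact hd _ _ _ _ h1 hwz hxw hxz hyw hyz
      · subst h2
        have h3 : G.Adj v y := by
          rcases h with h | ⟨-, h⟩ | ⟨h, -⟩
          exacts [(h1 h).elim, h, (hxy h.symm).elim]
        exact disjoint_union_left.2 ⟨hd _ _ _ _ huv hwz hxw hxz hw.symm hz.symm,
          hd _ _ _ _ h3 hwz hw.symm hz.symm hyw hyz⟩
      · obtain ⟨rfl, h3⟩ : y = u ∧ G.Adj x v := by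
          rcases h with h | ⟨h, -⟩ | h
          exacts [(h1 h).elim, (h2 h).elim, h]
        exact disjoint_union_left.2 ⟨hd _ _ _ _ h3 hwz hxw hxz hw.symm hz.symm,
          hd _ _ _ _ huv.symm hwz hw.symm hz.symm hyw hyz⟩
    by_cases hwz' : G.Adj w z
    · simpa only [hwz', if_true] using key x y w z hxy hx hy h hwz' hw hz hxw hxz hyw hyz
    · have hxy' : G.Adj x y := by
        rcases h with h | ⟨rfl, -⟩ | ⟨rfl, -⟩
        · exact h
        · rcases h' with h' | ⟨h', -⟩ | ⟨h', -⟩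
          exacts [(hwz' h').elim, (hxw h'.symm).elim, (hxz h'.symm).elim]
        · rcases h' with h' | ⟨h', -⟩ | ⟨h', -⟩
          exacts [(hwz' h').elim, (hyw h'.symm).elim, (hyz h'.symm).elim]
      simpa only [hxy', if_true] using (key w z x y hwz hw hz h' hxy' hx hy hxw.symm hyw.symm
        hxz.symm hyz.symm).symm

end AlmostPlanar

open Classical in
theorem SimpleGraph.card_edgeFinset_le_contractInto {V : Type*} [Fintype V] (G : SimpleGraph V)
    {u v : V} (huv : G.Adj u v) :
    G.edgeFinset.card ≤ (G.contractInto u v).edgeFinset.card + 1 +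
      (G.neighborFinset u ∩ G.neighborFinset v).card := by
  set A := G.edgeFinset.filter (fun e => v ∉ e) with hA
  set B := (G.neighborFinset v \ G.neighborFinset u).erase u with hB
  have hE : G.edgeFinset ⊆ A ∪ G.incidenceFinset v := by
    intro e he
    by_cases hv : v ∈ e
    · exact Finset.mem_union_right _ (by simpa using ⟨by simpa using he, hv⟩)
    · exact Finset.mem_union_left _ (by simp [hA, hv]; simpa using he)
  have h1 : G.edgeFinset.card ≤ A.card + G.degree v := by
    rw [← G.card_incidenceFinset_eq_degree]
    exact (Finset.card_le_card hE).trans (Finset.card_union_le _ _)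
  have h2 : G.degree v = B.card + 1 + (G.neighborFinset u ∩ G.neighborFinset v).card := by
    rw [← G.card_neighborFinset_eq_degree, Finset.card_erase_add_one, Finset.inter_comm]
    · exact (Finset.card_sdiff_add_card_inter _ _).symm
    · simp [huv.symm]
  have h3 : A ∪ B.image (fun x => s(u, x)) ⊆ (G.contractInto u v).edgeFinset := by
    intro e he
    rw [SimpleGraph.mem_edgeFinset]
    rcases Finset.mem_union.1 he with he | he
    · induction e with
      | _ x y =>
        simp [hA] at he
        exact ⟨he.1.ne, fun h => he.2.1 h.symm, fun h => he.2.2 h.symm, .inl he.1⟩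
    · obtain ⟨x, hx, rfl⟩ := Finset.mem_image.1 he
      simp [hB] at hx
      exact ⟨fun h => hx.1 h.symm, huv.ne, hx.2.1.ne', .inr (.inl ⟨rfl, hx.2.1⟩)⟩
  have h4 : A.card + B.card ≤ (G.contractInto u v).edgeFinset.card := by
    refine le_trans ?_ (Finset.card_le_card h3)
    rw [Finset.card_union_of_disjoint, Finset.card_image_of_injective]
    · intro x y h; exact Sym2.congr_right.1 h
    · rw [Finset.disjoint_left]
      intro e he he'
      obtain ⟨x, hx, rfl⟩ := Finset.mem_image.1 he'
      simp [hA] at he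
      simp [hB] at hx
      exact hx.2.2 he.1
  omega

namespace AlmostPlanar

variable {V : Type*} {G : SimpleGraph V}

theorem not_clique_five (hG : AlmostPlanar G) (s : Finset V) (hs : s.card = 5)
    (hc : G.IsClique s) : False := by
  let f := (Finset.equivFinOfCardEq hs).symm
  refine hG.not_complete_five (fun i => f i) fun i j hij => hc (f i).2 (f j).2 fun h => hij.ne ?_
  exact f.injective (Subtype.ext h)

open Classical in
theorem not_dense_neighborhood [Fintype V] (hG : AlmostPlanar G) (v : V)
    (h5 : (G.neighborFinset v).card ≤ 5) (hne : (G.neighborFinset v).Nonempty)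
    (ht : ∀ x ∈ G.neighborFinset v, 3 ≤ (G.neighborFinset x ∩ G.neighborFinset v).card) :
    False := by
  set N := G.neighborFinset v with hN
  have hvN : ∀ x ∈ N, G.Adj v x := fun x hx => by simpa [hN] using hx
  have hmiss : ∀ x ∈ N, ∀ T ⊆ N.erase x, (∀ y ∈ T, ¬ G.Adj x y) → T.card + 4 ≤ N.card := by
    intro x hx T hT hxT
    have hd : Disjoint (G.neighborFinset x ∩ N) T := by
      rw [Finset.disjoint_left]
      intro y hy hyT
      exact hxT y hyT (by simpa using (Finset.mem_inter.1 hy).1)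
    have hsub : (G.neighborFinset x ∩ N) ∪ T ⊆ N.erase x := by
      refine Finset.union_subset ?_ hT
      intro y hy
      simp only [Finset.mem_inter, SimpleGraph.mem_neighborFinset] at hy
      exact Finset.mem_erase.2 ⟨hy.1.ne', hy.2⟩
    have h1 := Finset.card_le_card hsub
    rw [Finset.card_union_of_disjoint hd, Finset.card_erase_of_mem hx] at h1
    have h2 := ht x hx
    omega
  have hclique : ∀ s ⊆ N, s.card = 4 → ¬ G.IsClique s := by
    intro s hs h4 hc
    have hvs : v ∉ s := fun h => (hvN v (hs h)).ne rfl
    refine hG.not_clique_five (insert v s) (by rw [Finset.card_insert_of_notMem hvs, h4]) ?_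
    rw [Finset.coe_insert]
    exact hc.insert fun b hb _ => hvN b (hs hb)
  have hnonadj : ∀ s ⊆ N, s.card = 4 → ∃ x ∈ s, ∃ y ∈ s, x ≠ y ∧ ¬ G.Adj x y := by
    intro s hs h4
    have := hclique s hs h4
    simp only [SimpleGraph.isClique_iff, Set.Pairwise] at this
    push Not at this
    obtain ⟨x, hx, y, hy, h⟩ := this
    exact ⟨x, hx, y, hy, h⟩
  have hpair : ∀ x ∈ N, ∀ y ∈ N, ∀ z ∈ N, y ≠ x → z ≠ x → y ≠ z → ¬ G.Adj x y → G.Adj x z := by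
    intro x hx y hy z hz hyx hzx hyz hxy
    by_contra hxz
    have := hmiss x hx {y, z} (by
      intro w hw
      rcases Finset.mem_insert.1 hw with rfl | hw
      · exact Finset.mem_erase.2 ⟨hyx, hy⟩
      · rw [Finset.mem_singleton.1 hw]
        exact Finset.mem_erase.2 ⟨hzx, hz⟩) (by
      intro w hw
      rcases Finset.mem_insert.1 hw with rfl | hw
      · exact hxy
      · rwa [Finset.mem_singleton.1 hw])
    rw [Finset.card_pair hyz] at this
    omega
  obtain ⟨x₀, hx₀⟩ := hne
  have h4 : 4 ≤ N.card := by
    simpa using hmiss x₀ hx₀ ∅ (Finset.empty_subset _) (by simp)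
  obtain ⟨s, hsN, hs⟩ := Finset.exists_subset_card_eq h4
  obtain ⟨a, ha, b, hb, hab, hnab⟩ := hnonadj s hsN hs
  replace ha := hsN ha
  replace hb := hsN hb
  have h5' : N.card = 5 := by
    have := hmiss a ha {b} (by simpa using ⟨hab.symm, hb⟩) (by simpa using hnab)
    simp at this
    omega
  obtain ⟨c, hc, d, hd, hcd, hncd⟩ := hnonadj (N.erase a) (Finset.erase_subset _ _)
    (by rw [Finset.card_erase_of_mem ha, h5'])
  obtain ⟨hca, hc⟩ := Finset.mem_erase.1 hc
  obtain ⟨hda, hd⟩ := Finset.mem_erase.1 hd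
  have hcb : c ≠ b := by
    rintro rfl
    exact hncd (hpair c hc a ha d hd hca.symm hcd.symm hda.symm fun h => hnab h.symm)
  have hdb : d ≠ b := by
    rintro rfl
    exact hnab (hpair d hd c hc a ha hcd hab hca fun h => hncd h.symm).symm
  obtain ⟨e, he, heS⟩ : ∃ e ∈ N, e ∉ ({a, b, c, d} : Finset V) :=
    Finset.exists_mem_notMem_of_card_lt_card (by
      rw [h5']; exact lt_of_le_of_lt Finset.card_le_four (by norm_num))
  simp only [Finset.mem_insert, Finset.mem_singleton, not_or] at heS
  obtain ⟨hea, heb, hec, hed⟩ := heS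
  have hac : G.Adj a c := hpair a ha b hb c hc hab.symm hca hcb.symm hnab
  have had : G.Adj a d := hpair a ha b hb d hd hab.symm hda hdb.symm hnab
  have hae : G.Adj a e := hpair a ha b hb e he hab.symm hea (Ne.symm heb) hnab
  have hnba : ¬ G.Adj b a := fun h => hnab h.symm
  have hbd : G.Adj b d := hpair b hb a ha d hd hab hdb hda.symm hnba
  have hbe : G.Adj b e := hpair b hb a ha e he hab heb (Ne.symm hea) hnba
  have hcb' : G.Adj c b := hpair c hc d hd b hb hcd.symm hcb.symm hdb hncd
  have hde : G.Adj d e := hpair d hd c hc e he hcd hed (Ne.symm hec) fun h => hncd h.symm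
  have hvc := (hvN c hc).ne
  have hK : ∀ x y, x ≠ c → y ≠ c → G.Adj x y → (G.contractInto a c).Adj x y :=
    fun x y hx hy h => ⟨h.ne, hx, hy, .inl h⟩
  refine (hG.contractInto hac).not_complete_five ![v, a, b, d, e] ?_
  have e01 := hK v a hvc hca.symm (hvN a ha)
  have e02 := hK v b hvc hcb.symm (hvN b hb)
  have e03 := hK v d hvc hcd.symm (hvN d hd)
  have e04 := hK v e hvc hec (hvN e he)
  have e12 : (G.contractInto a c).Adj a b := ⟨hab, hca.symm, hcb.symm, .inr (.inl ⟨rfl, hcb'⟩)⟩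
  have e13 := hK a d hca.symm hcd.symm had
  have e14 := hK a e hca.symm hec hae
  have e23 := hK b d hcb.symm hcd.symm hbd
  have e24 := hK b e hcb.symm hec hbe
  have e34 := hK d e hcd.symm hec hde
  intro i j hij
  fin_cases i <;> fin_cases j <;> first | (exact absurd hij (by decide)) | assumption

open Classical in
/-- An almost planar graph supported on `n ≥ 3` vertices has at most `3n - 6` edges. -/
theorem card_edgeFinset_add_six_le [Fintype V] (n : ℕ) (hn : 3 ≤ n) :
    ∀ (G : SimpleGraph V) (_ : AlmostPlanar G) (A : Finset V) (_ : A.card = n)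
      (_ : ∀ u v, G.Adj u v → u ∈ A), G.edgeFinset.card + 6 ≤ 3 * n := by
  have hsum : ∀ (G : SimpleGraph V) (A : Finset V) (_ : ∀ u v, G.Adj u v → u ∈ A),
      ∑ v ∈ A, G.degree v = 2 * G.edgeFinset.card := by
    intro G A hA
    rw [← G.sum_degrees_eq_twice_card_edges]
    refine Finset.sum_subset (Finset.subset_univ _) fun v _ hv => ?_
    rw [SimpleGraph.degree_eq_zero_iff_notMem_support]
    rintro ⟨w, hw⟩
    exact hv (hA v w hw)
  induction n, hn using Nat.le_induction with
  | base =>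
    intro G _ A hA hsupp
    have h1 := hsum G A hsupp
    have h2 : ∑ v ∈ A, G.degree v ≤ ∑ v ∈ A, 2 := by
      refine Finset.sum_le_sum fun v hv => ?_
      rw [← G.card_neighborFinset_eq_degree]
      have : G.neighborFinset v ⊆ A.erase v := by
        intro w hw
        rw [SimpleGraph.mem_neighborFinset] at hw
        exact Finset.mem_erase.2 ⟨hw.ne', hsupp w v hw.symm⟩
      simpa [Finset.card_erase_of_mem hv, hA] using Finset.card_le_card this
    simp [hA] at h2
    omega
  | succ n hn ih =>
    intro G hG A hA hsupp
    by_contra hlt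
    obtain ⟨E, hEG, hE⟩ := Finset.exists_subset_card_eq
      (show 3 * (n + 1) - 5 ≤ G.edgeFinset.card by omega)
    obtain ⟨H, hH⟩ : ∃ H : SimpleGraph V, H = SimpleGraph.fromEdgeSet (E : Set (Sym2 V)) :=
      ⟨_, rfl⟩
    have hHE : H.edgeFinset = E := by
      ext e
      rw [SimpleGraph.mem_edgeFinset, hH, SimpleGraph.edgeSet_fromEdgeSet]
      refine ⟨fun h => h.1, fun h => ⟨h, fun hd => ?_⟩⟩
      have := hEG h
      rw [SimpleGraph.mem_edgeFinset] at this
      exact G.not_isDiag_of_mem_edgeSet this hd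
    have hHG : H ≤ G := by
      rw [← SimpleGraph.edgeFinset_subset_edgeFinset, hHE]
      exact hEG
    rw [← hHE] at hE
    have hHp := hG.mono hHG
    replace hsupp : ∀ u v, H.Adj u v → u ∈ A := fun u v h => hsupp u v (hHG h)
    have htri : ∀ u v, H.Adj u v → 3 ≤ (H.neighborFinset u ∩ H.neighborFinset v).card := by
      intro u v huv
      have h1 := H.card_edgeFinset_le_contractInto huv
      have h2 := ih (H.contractInto u v) (hHp.contractInto huv) (A.erase v)
        (by rw [Finset.card_erase_of_mem (hsupp v u huv.symm), hA]; rfl) (by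
          rintro x y ⟨-, hx, -, h⟩
          refine Finset.mem_erase.2 ⟨hx, ?_⟩
          rcases h with h | ⟨rfl, -⟩ | ⟨-, h⟩
          exacts [hsupp _ _ h, hsupp _ _ huv, hsupp _ _ h])
      omega
    obtain ⟨v, hv, hv5⟩ : ∃ v ∈ A, H.degree v ≤ 5 := by
      by_contra! hcon
      have h1 : ∑ v ∈ A, 6 ≤ ∑ v ∈ A, H.degree v := Finset.sum_le_sum fun v hv => hcon v hv
      rw [hsum H A hsupp] at h1
      simp [hA] at h1
      omega
    refine hHp.not_dense_neighborhood v (by simpa using hv5) ?_ fun x hx => ?_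
    · rw [Finset.nonempty_iff_ne_empty]
      intro h0
      have h2 := ih H hHp (A.erase v) (by rw [Finset.card_erase_of_mem hv, hA]; rfl) (by
        intro x y hxy
        refine Finset.mem_erase.2 ⟨?_, hsupp x y hxy⟩
        rintro rfl
        have : y ∈ H.neighborFinset x := by simpa using hxy
        simp [h0] at this)
      omega
    · exact htri x v (by simpa using SimpleGraph.Adj.symm (by simpa using hx))

end AlmostPlanar

/-- The part of the arc `α` after (`i = true`) or before (`i = false`) the parameter `t`. -/
def halfArc (α : ℝ → ℝ × ℝ) (t : ℝ) (i : Bool) : Set (ℝ × ℝ) :=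
  α '' (cond i (Ioc t 1) (Ico 0 t))

theorem halfArc_subset (α : ℝ → ℝ × ℝ) {t : ℝ} (ht : t ∈ Ioo (0 : ℝ) 1) (i : Bool) :
    halfArc α t i ⊆ α '' Icc 0 1 := by
  refine image_mono ?_
  cases i
  · exact fun x hx => ⟨hx.1, hx.2.le.trans ht.2.le⟩
  · exact fun x hx => ⟨ht.1.le.trans hx.1.le, hx.2⟩

theorem halfArc_disjoint {α : ℝ → ℝ × ℝ} (hα : InjOn α (Icc 0 1)) {t : ℝ}
    (ht : t ∈ Ioo (0 : ℝ) 1) (i : Bool) : Disjoint (halfArc α t i) (halfArc α t !i) := by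
  have h : Disjoint (halfArc α t false) (halfArc α t true) := by
    rw [Set.disjoint_left]
    rintro _ ⟨x, hx, rfl⟩ ⟨y, hy, hxy⟩
    have := hα ⟨ht.1.le.trans hy.1.le, hy.2⟩ ⟨hx.1, hx.2.le.trans ht.2.le⟩ hxy
    have h1 : x < t := hx.2
    have h2 : t < y := hy.1
    linarith
  cases i
  exacts [h, h.symm]

theorem notMem_halfArc {α : ℝ → ℝ × ℝ} (hα : InjOn α (Icc 0 1)) {t : ℝ}
    (ht : t ∈ Ioo (0 : ℝ) 1) (i : Bool) : α t ∉ halfArc α t i := by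
  rintro ⟨x, hx, h⟩
  cases i
  · have := hα ⟨hx.1, hx.2.le.trans ht.2.le⟩ ⟨ht.1.le, ht.2.le⟩ h
    exact hx.2.ne this
  · have := hα ⟨ht.1.le.trans hx.1.le, hx.2⟩ ⟨ht.1.le, ht.2.le⟩ h
    exact hx.1.ne' this

theorem endpoint_mem_halfArc (α : ℝ → ℝ × ℝ) {t : ℝ} (ht : t ∈ Ioo (0 : ℝ) 1) (i : Bool) :
    α (cond i 1 0) ∈ halfArc α t i := by
  cases i
  · exact ⟨0, ⟨le_rfl, ht.1⟩, rfl⟩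
  · exact ⟨1, ⟨ht.2, le_rfl⟩, rfl⟩

theorem isPathConnected_halfArc {α : ℝ → ℝ × ℝ} (hα : ContinuousOn α (Icc 0 1)) {t : ℝ}
    (ht : t ∈ Ioo (0 : ℝ) 1) (i : Bool) : IsPathConnected (halfArc α t i) := by
  cases i
  · exact ((convex_Ico 0 t).isPathConnected ⟨0, le_rfl, ht.1⟩).image'
      (hα.mono fun x hx => ⟨hx.1, hx.2.le.trans ht.2.le⟩)
  · exact ((convex_Ioc t 1).isPathConnected ⟨1, ht.2, le_rfl⟩).image'
      (hα.mono fun x hx => ⟨ht.1.le.trans hx.1.le, hx.2⟩)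

/-- A line embedded in an arc passes from one side of each of its points to the other. -/
theorem exists_sign_mem_halfArc {α : ℝ → ℝ × ℝ} (hc : ContinuousOn α (Icc 0 1))
    (hi : InjOn α (Icc 0 1)) {t : ℝ} (ht : t ∈ Ioo (0 : ℝ) 1) {g : ℝ → ℝ × ℝ}
    (hg : Continuous g) (hgi : Function.Injective g) (hgα : ∀ x, g x ∈ α '' Icc 0 1)
    (h0 : g 0 = α t) :
    ∃ s : Bool → ℝ, s false = -s true ∧ s true ≠ 0 ∧
      ∀ i x, 0 < x → g (x * s i) ∈ halfArc α t i := by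
  choose h hI hh using hgα
  have hemb : Topology.IsClosedEmbedding (fun x : Icc (0 : ℝ) 1 => α x) :=
    Continuous.isClosedEmbedding (continuousOn_iff_continuous_domRestrict.1 hc)
      (fun x y hxy => Subtype.ext (hi x.2 y.2 hxy))
  have hcont : Continuous h := by
    have : Continuous (fun x => (⟨h x, hI x⟩ : Icc (0 : ℝ) 1)) := by
      rw [hemb.isEmbedding.continuous_iff]
      simpa [Function.comp_def, hh] using hg
    exact continuous_subtype_val.comp this
  have hinj : Function.Injective h := fun x y hxy => hgi (by rw [← hh, ← hh, hxy])
  have hh0 : h 0 = t := hi (hI 0) ⟨ht.1.le, ht.2.le⟩ (by rw [hh, h0])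
  rcases hcont.strictMono_of_inj hinj with hm | hm
  · refine ⟨fun i => cond i 1 (-1), rfl, one_ne_zero, fun i x hx => ⟨h _, ?_, hh _⟩⟩
    cases i
    · exact ⟨(hI _).1, hh0 ▸ hm (by simpa using hx)⟩
    · exact ⟨hh0 ▸ hm (by simpa using hx), (hI _).2⟩
  · refine ⟨fun i => cond i (-1) 1, by simp, by simp, fun i x hx => ⟨h _, ?_, hh _⟩⟩
    cases i
    · exact ⟨(hI _).1, hh0 ▸ hm (by simpa using hx)⟩
    · exact ⟨hh0 ▸ hm (by simpa using hx), (hI _).2⟩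

/-- Around a proper crossing of two arcs, the four half arcs can be joined cyclically within the
four quadrants of an arbitrarily small neighbourhood. -/
theorem ProperCross.exists_quadrants {α β : ℝ → ℝ × ℝ} {p : ℝ × ℝ}
    (hp : ProperCross (α '' Icc 0 1) (β '' Icc 0 1) p)
    (hαc : ContinuousOn α (Icc 0 1)) (hαi : InjOn α (Icc 0 1))
    (hβc : ContinuousOn β (Icc 0 1)) (hβi : InjOn β (Icc 0 1))
    {t u : ℝ} (ht : t ∈ Ioo (0 : ℝ) 1) (hu : u ∈ Ioo (0 : ℝ) 1) (hαt : α t = p) (hβu : β u = p)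
    {W : Set (ℝ × ℝ)} (hW : IsOpen W) (hpW : p ∈ W) :
    ∃ Q : Bool → Bool → Set (ℝ × ℝ), (∀ i j, Q i j ⊆ W) ∧
      (∀ i j, Disjoint (Q i j) (α '' Icc 0 1)) ∧ (∀ i j, Disjoint (Q i j) (β '' Icc 0 1)) ∧
      (∀ i j, Disjoint (Q i j) (Q (!i) (!j))) ∧
      ∀ i j, JoinedIn (halfArc α t i ∪ Q i j ∪ halfArc β u j) (α (cond i 1 0)) (β (cond j 1 0)) := by
  obtain ⟨U, -, hpU, φ, hφp, hφα, hφβ⟩ := hp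
  obtain ⟨g, hgdef⟩ : ∃ g : ℝ × ℝ → ℝ × ℝ, g = fun q => (φ.symm q : ℝ × ℝ) := ⟨_, rfl⟩
  have hg : Continuous g := by rw [hgdef]; fun_prop
  have hgi : Function.Injective g := by
    rw [hgdef]; exact Subtype.val_injective.comp φ.symm.injective
  have hg0 : g (0, 0) = p := by rw [hgdef, ← hφp]; simp
  have hgα : ∀ q, g q ∈ α '' Icc 0 1 ↔ q.2 = 0 := by
    intro q
    have : q ∈ {q : ℝ × ℝ | q.2 = 0} ↔ q.2 = 0 := Iff.rfl
    rw [← this, ← hφα, hgdef]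
    constructor
    · exact fun h => ⟨φ.symm q, h, by simp⟩
    · rintro ⟨x, hx, rfl⟩
      simpa using hx
  have hgβ : ∀ q, g q ∈ β '' Icc 0 1 ↔ q.1 = 0 := by
    intro q
    have : q ∈ {q : ℝ × ℝ | q.1 = 0} ↔ q.1 = 0 := Iff.rfl
    rw [← this, ← hφβ, hgdef]
    constructor
    · exact fun h => ⟨φ.symm q, h, by simp⟩
    · rintro ⟨x, hx, rfl⟩
      simpa using hx
  obtain ⟨a, ha, ha0, haH⟩ := exists_sign_mem_halfArc hαc hαi ht (g := fun x => g (x, 0))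
    (by fun_prop) (fun x y h => congrArg Prod.fst (hgi h)) (fun x => (hgα _).2 rfl)
    (hg0.trans hαt.symm)
  obtain ⟨b, hb, hb0, hbH⟩ := exists_sign_mem_halfArc hβc hβi hu (g := fun x => g (0, x))
    (by fun_prop) (fun x y h => congrArg Prod.snd (hgi h)) (fun x => (hgβ _).2 rfl)
    (hg0.trans hβu.symm)
  have hane : ∀ i, a i ≠ 0 := fun i => by cases i <;> simp [ha, ha0]
  have hbne : ∀ i, b i ≠ 0 := fun i => by cases i <;> simp [hb, hb0]
  have hanot : ∀ i, a (!i) = -a i := fun i => by cases i <;> simp [ha]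
  -- small multiples of the quadrants lie in `W`
  have hsmall : ∃ ε > 0, ∀ x y : ℝ, |x| ≤ ε → |y| ≤ ε → ∀ i j, g (x * a i, y * b j) ∈ W := by
    have hev : ∀ i j, ∃ ε > 0, ∀ x y : ℝ, |x| ≤ ε → |y| ≤ ε → g (x * a i, y * b j) ∈ W := by
      intro i j
      have hopen : IsOpen ((fun q : ℝ × ℝ => g (q.1 * a i, q.2 * b j)) ⁻¹' W) :=
        hW.preimage (by fun_prop)
      obtain ⟨ε, hε, hsub⟩ := Metric.isOpen_iff.1 hopen (0, 0) (by simpa [hg0] using hpW)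
      refine ⟨ε / 2, half_pos hε, fun x y hx hy => ?_⟩
      refine hsub (show (x, y) ∈ Metric.ball (0, 0) ε from ?_)
      rw [Metric.mem_ball, Prod.dist_eq]
      simp only [Real.dist_eq, sub_zero]
      exact (max_le hx hy).trans_lt (half_lt_self hε)
    choose ε hε hsub using hev
    refine ⟨min (min (ε false false) (ε false true)) (min (ε true false) (ε true true)), ?_, ?_⟩
    · simp [hε]
    · intro x y hx hy i j
      simp only [le_min_iff] at hx hy
      refine hsub i j x y ?_ ?_ <;> cases i <;> cases j <;> tauto
  obtain ⟨ε, hε, hεW⟩ := hsmall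
  refine ⟨fun i j => (fun q : ℝ × ℝ => g (q.1 * a i, q.2 * b j)) '' (Ioc 0 ε ×ˢ Ioc 0 ε),
    ?_, ?_, ?_, ?_, ?_⟩
  · rintro i j _ ⟨q, ⟨hx, hy⟩, rfl⟩
    exact hεW _ _ (by rw [abs_of_pos hx.1]; exact hx.2) (by rw [abs_of_pos hy.1]; exact hy.2) i j
  · intro i j
    rw [Set.disjoint_left]
    rintro _ ⟨q, ⟨hx, hy⟩, rfl⟩ h
    exact mul_ne_zero hy.1.ne' (hbne j) ((hgα _).1 h)
  · intro i j
    rw [Set.disjoint_left]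
    rintro _ ⟨q, ⟨hx, hy⟩, rfl⟩ h
    exact mul_ne_zero hx.1.ne' (hane i) ((hgβ _).1 h)
  · intro i j
    rw [Set.disjoint_left]
    rintro _ ⟨q, ⟨hx, hy⟩, rfl⟩ ⟨q', ⟨hx', hy'⟩, h⟩
    have h1 : q'.1 * a (!i) = q.1 * a i := congrArg Prod.fst (hgi h)
    have h2 : (q'.1 + q.1) * a i = 0 := by rw [hanot] at h1; linear_combination -h1
    have h3 := (mul_eq_zero.1 h2).resolve_right (hane i)
    have := hx.1
    have := hx'.1
    linarith
  · intro i j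
    have hA : g (ε * a i, 0) ∈ halfArc α t i := haH i ε hε
    have hB : g (0, ε * b j) ∈ halfArc β u j := hbH j ε hε
    have j1 := (isPathConnected_halfArc hαc ht i).joinedIn _ (endpoint_mem_halfArc α ht i) _ hA
    have j3 := (isPathConnected_halfArc hβc hu j).joinedIn _ hB _ (endpoint_mem_halfArc β hu j)
    have hf : Continuous fun x : ℝ => g ((ε * (1 - x)) * a i, (ε * x) * b j) := by fun_prop
    have j2 := (((convex_Icc (0 : ℝ) 1).isPathConnected ⟨0, by simp⟩).image hf).joinedIn
      (g (ε * a i, 0)) ⟨0, by simp⟩ (g (0, ε * b j)) ⟨1, by simp⟩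
    refine ((j1.mono ?_).trans (j2.mono ?_)).trans (j3.mono ?_)
    · exact subset_union_left.trans subset_union_left
    · rintro _ ⟨x, hx, rfl⟩
      rcases hx.1.eq_or_lt with rfl | hx0
      · left; left; simpa using hA
      rcases hx.2.eq_or_lt with rfl | hx1
      · right; simpa using hB
      left; right
      refine ⟨(ε * (1 - x), ε * x), ⟨⟨?_, ?_⟩, ⟨?_, ?_⟩⟩, rfl⟩
      · exact mul_pos hε (by linarith)
      · show ε * (1 - x) ≤ ε
        nlinarith
      · exact mul_pos hε hx0
      · show ε * x ≤ ε
        nlinarith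
    · exact subset_union_right

namespace Drawing

variable {V : Type*} {G : SimpleGraph V}

theorem exists_endpoints (D : Drawing G) : ∃ en : G.edgeSet → Bool → V, ∀ e : G.edgeSet,
    (e : Sym2 V) = s(en e false, en e true) ∧ ∀ i, D.arc e (cond i 1 0) = D.pos (en e i) := by
  choose u v h using D.arc_ends
  refine ⟨fun e i => cond i (v e) (u e), fun e => ⟨(h e).1, fun i => ?_⟩⟩
  cases i
  exacts [(h e).2.1, (h e).2.2]

theorem exists_param_s1 (D : Drawing G) {e : G.edgeSet} {p : ℝ × ℝ} (hp : p ∉ range D.pos)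
    (hpe : p ∈ D.arcIm e) : ∃ t ∈ Ioo (0 : ℝ) 1, D.arc e t = p := by
  obtain ⟨u, v, -, hu, hv⟩ := D.arc_ends e
  obtain ⟨t, ht, rfl⟩ := hpe
  refine ⟨t, ⟨ht.1.lt_of_ne ?_, ht.2.lt_of_ne ?_⟩, rfl⟩
  · rintro rfl; exact hp ⟨u, hu.symm⟩
  · rintro rfl; exact hp ⟨v, hv.symm⟩

theorem isClosed_arcIm_s1 (D : Drawing G) (e : G.edgeSet) : IsClosed (D.arcIm e) :=
  (isCompact_Icc.image_of_continuousOn (D.arc_cont e)).isClosed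

theorem mem_of_pos_mem_arcIm (D : Drawing G) {e : G.edgeSet} {v : V} (h : D.pos v ∈ D.arcIm e) :
    v ∈ (e : Sym2 V) := by
  by_contra hv
  exact D.no_vertex_interior e v hv h

/-- A one-planar drawing with finitely many crossings gives an almost planar graph: around each
crossing, the four sides of the kite and one of the two crossing edges can be drawn. -/
theorem IsOnePlanar.exists_kites [Finite V] {D : Drawing G} (h1 : D.IsOnePlanar)
    (hfin : D.crossings.Finite) :
    ∃ F : D.crossings × Option (Bool × Bool) → Sym2 V,
      AlmostPlanar (SimpleGraph.fromEdgeSet (range F)) ∧ (∀ k, ¬ (F k).IsDiag) ∧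
      (∀ p x v, v ∈ F (p, x) → v ∈ D.cluster p) ∧ ∀ p x y, F (p, x) = F (p, y) → x = y := by
  obtain ⟨en, hen⟩ := D.exists_endpoints
  have hens : ∀ (e : G.edgeSet) i, (e : Sym2 V) = s(en e i, en e !i) := by
    intro e i
    cases i
    · exact (hen e).1
    · rw [(hen e).1]; exact Sym2.eq_swap
  have henm : ∀ (e : G.edgeSet) i, en e i ∈ (e : Sym2 V) := fun e i => by
    rw [hens e i]; exact Sym2.mem_mk_left _ _
  have henne : ∀ e i, en e i ≠ en e !i := by
    intro e i h
    have := e.2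
    rw [hens e i, h] at this
    exact G.loopless.irrefl _ this
  have hinc : ∀ (e : G.edgeSet) v i, v ∈ (e : Sym2 V) → v = en e i ∨ v = en e !i := by
    intro e v i hv
    rwa [hens e i, Sym2.mem_iff] at hv
  have hE : ∀ p : D.crossings, ∃ e₁ e₂ : G.edgeSet, e₁ ≠ e₂ ∧ (p : ℝ × ℝ) ∈ D.arcIm e₁ ∧
      (p : ℝ × ℝ) ∈ D.arcIm e₂ := fun p => p.2.2
  choose E₁ E₂ hne hE₁ hE₂ using hE
  have hthird : ∀ (p : D.crossings) e, (p : ℝ × ℝ) ∈ D.arcIm e → e = E₁ p ∨ e = E₂ p := by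
    intro p e he
    rcases D.at_most_two p p.2.1 e (E₁ p) (E₂ p) he (hE₁ p) (hE₂ p) with h | h | h
    exacts [.inl h, .inr h, (hne p h).elim]
  have hvert : ∀ (p : D.crossings) v, v ∈ (E₁ p : Sym2 V) → v ∈ (E₂ p : Sym2 V) → False :=
    fun p v hv hv' => p.2.1 ⟨v, (D.shared_endpoint _ _ (hne p) v hv hv' ⟨hE₁ p, hE₂ p⟩).symm⟩
  have hmeet : ∀ (p : D.crossings) z, z ∈ D.arcIm (E₁ p) → z ∈ D.arcIm (E₂ p) → z = p := by
    intro p z hz hz'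
    by_cases hzv : z ∈ range D.pos
    · obtain ⟨v, rfl⟩ := hzv
      exact (hvert p v (D.mem_of_pos_mem_arcIm hz) (D.mem_of_pos_mem_arcIm hz')).elim
    · exact h1 (E₁ p) ⟨⟨hzv, _, _, hne p, hz, hz'⟩, hz⟩ ⟨p.2, hE₁ p⟩
  choose t₁ ht₁ hpt₁ using fun p : D.crossings => D.exists_param_s1 p.2.1 (hE₁ p)
  choose t₂ ht₂ hpt₂ using fun p : D.crossings => D.exists_param_s1 p.2.1 (hE₂ p)
  obtain ⟨U, hU, hUd⟩ := hfin.t2_separation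
  have hW : ∀ p : D.crossings, IsOpen (U p ∩ ⋂ e : {e // (p : ℝ × ℝ) ∉ D.arcIm e},
      (D.arcIm e)ᶜ) := fun p =>
    (hU p).2.inter (isOpen_iInter_of_finite fun e => (D.isClosed_arcIm_s1 e).isOpen_compl)
  have hQ : ∀ p : D.crossings, _ := fun p =>
    (D.proper _ _ (hne p) p ⟨hE₁ p, hE₂ p⟩ p.2.1).exists_quadrants (D.arc_cont _) (D.arc_inj _)
      (D.arc_cont _) (D.arc_inj _) (ht₁ p) (ht₂ p) (hpt₁ p) (hpt₂ p) (hW p)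
      ⟨(hU p).1, mem_iInter.2 fun e => e.2⟩
  choose Q hQW hQ₁ hQ₂ hQQ hQj using hQ
  have hQarc : ∀ p i j e, Disjoint (Q p i j) (D.arcIm e) := by
    intro p i j e
    by_cases he : (p : ℝ × ℝ) ∈ D.arcIm e
    · rcases hthird p e he with rfl | rfl
      exacts [hQ₁ p i j, hQ₂ p i j]
    · rw [Set.disjoint_left]
      intro z hz
      exact mem_iInter.1 (hQW p i j hz).2 ⟨e, he⟩
  let F : D.crossings × Option (Bool × Bool) → Sym2 V := fun k =>
    k.2.elim (E₁ k.1 : Sym2 V) fun ij => s(en (E₁ k.1) ij.1, en (E₂ k.1) ij.2)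
  let T : D.crossings × Option (Bool × Bool) → Set (ℝ × ℝ) := fun k =>
    k.2.elim (D.arcIm (E₁ k.1)) fun ij => halfArc (D.arc (E₁ k.1)) (t₁ k.1) ij.1 ∪
      Q k.1 ij.1 ij.2 ∪ halfArc (D.arc (E₂ k.1)) (t₂ k.1) ij.2
  have hhalf : ∀ e t, t ∈ Ioo (0 : ℝ) 1 → ∀ i v, D.pos v ∈ halfArc (D.arc e) t i →
      v = en e i := by
    intro e t ht i v hv
    rcases hinc e v i (D.mem_of_pos_mem_arcIm (halfArc_subset _ ht i hv)) with h | h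
    · exact h
    · rw [h, ← (hen e).2] at hv
      exact (Set.disjoint_left.1 (halfArc_disjoint (D.arc_inj e) ht i) hv
        (endpoint_mem_halfArc _ ht _)).elim
  -- a point of a drawn edge lies in a quadrant or on an arc through the crossing
  have hT : ∀ p x z, z ∈ T (p, x) → (∃ i j, z ∈ Q p i j) ∨
      ∃ e, (p : ℝ × ℝ) ∈ D.arcIm e ∧ z ∈ D.arcIm e ∧ ∀ v, z = D.pos v → v ∈ F (p, x) := by
    rintro p (_ | ⟨i, j⟩) z hz
    · refine .inr ⟨E₁ p, hE₁ p, hz, ?_⟩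
      rintro v rfl
      exact D.mem_of_pos_mem_arcIm hz
    · rcases hz with (hz | hz) | hz
      · refine .inr ⟨E₁ p, hE₁ p, halfArc_subset _ (ht₁ p) i hz, ?_⟩
        rintro v rfl
        exact Sym2.mem_iff.2 (.inl (hhalf _ _ (ht₁ p) i v hz))
      · exact .inl ⟨i, j, hz⟩
      · refine .inr ⟨E₂ p, hE₂ p, halfArc_subset _ (ht₂ p) j hz, ?_⟩
        rintro v rfl
        exact Sym2.mem_iff.2 (.inr (hhalf _ _ (ht₂ p) j v hz))
  have hdisj : ∀ k k', (∀ v, v ∈ F k → v ∉ F k') → Disjoint (T k) (T k') := by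
    rintro ⟨p, x⟩ ⟨q, y⟩ hF
    by_cases hpq : p = q
    · subst hpq
      rcases x with _ | ⟨i, j⟩ <;> rcases y with _ | ⟨i', j'⟩
      · exact (hF (en (E₁ p) true) (henm _ _) (henm _ _)).elim
      · exact (hF (en (E₁ p) i') (henm _ _) (Sym2.mem_mk_left _ _)).elim
      · exact (hF (en (E₁ p) i) (Sym2.mem_mk_left _ _) (henm _ _)).elim
      have hi : i' = !i := by
        refine Bool.eq_not.2 ?_
        rintro rfl
        exact hF _ (Sym2.mem_mk_left _ _) (Sym2.mem_mk_left _ _)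
      have hj : j' = !j := by
        refine Bool.eq_not.2 ?_
        rintro rfl
        exact hF _ (Sym2.mem_mk_right _ _) (Sym2.mem_mk_right _ _)
      subst hi hj
      have hcross : ∀ i j, Disjoint (halfArc (D.arc (E₁ p)) (t₁ p) i)
          (halfArc (D.arc (E₂ p)) (t₂ p) j) := by
        intro i j
        rw [Set.disjoint_left]
        intro z hz hz'
        have := hmeet p z (halfArc_subset _ (ht₁ p) i hz) (halfArc_subset _ (ht₂ p) j hz')
        rw [this, ← hpt₁ p] at hz
        exact notMem_halfArc (D.arc_inj _) (ht₁ p) i hz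
      have hQh₁ : ∀ i j i', Disjoint (Q p i j) (halfArc (D.arc (E₁ p)) (t₁ p) i') :=
        fun i j i' => (hQ₁ p i j).mono_right (halfArc_subset _ (ht₁ p) i')
      have hQh₂ : ∀ i j j', Disjoint (Q p i j) (halfArc (D.arc (E₂ p)) (t₂ p) j') :=
        fun i j j' => (hQ₂ p i j).mono_right (halfArc_subset _ (ht₂ p) j')
      simp only [T, Option.elim_some, Set.disjoint_union_left, Set.disjoint_union_right]
      exact ⟨⟨⟨⟨halfArc_disjoint (D.arc_inj _) (ht₁ p) i, hQh₁ _ _ _⟩, (hcross _ _).symm⟩,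
        ⟨(hQh₁ _ _ _).symm, hQQ p i j⟩, (hQh₂ _ _ _).symm⟩,
        ⟨hcross _ _, hQh₂ _ _ _⟩, halfArc_disjoint (D.arc_inj _) (ht₂ p) j⟩
    · rw [Set.disjoint_left]
      intro z hz hz'
      rcases hT p x z hz with ⟨i, j, hzQ⟩ | ⟨e, hpe, hze, hzv⟩ <;>
        rcases hT q y z hz' with ⟨i', j', hzQ'⟩ | ⟨e', hqe, hze', hzv'⟩
      · exact Set.disjoint_left.1 (hUd p.2 q.2 fun h => hpq (Subtype.ext h))
          (hQW p i j hzQ).1 (hQW q i' j' hzQ').1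
      · exact Set.disjoint_left.1 (hQarc p i j e') hzQ hze'
      · exact Set.disjoint_left.1 (hQarc q i' j' e) hzQ' hze
      · have hee : e ≠ e' := by
          rintro rfl
          exact hpq (Subtype.ext (h1 e ⟨p.2, hpe⟩ ⟨q.2, hqe⟩))
        by_cases hzr : z ∈ range D.pos
        · obtain ⟨v, rfl⟩ := hzr
          exact hF v (hzv v rfl) (hzv' v rfl)
        · have hzc : z ∈ D.crossings := ⟨hzr, e, e', hee, hze, hze'⟩
          have hzp := h1 e ⟨hzc, hze⟩ ⟨p.2, hpe⟩
          have hzq := h1 e' ⟨hzc, hze'⟩ ⟨q.2, hqe⟩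
          exact hpq (Subtype.ext (hzp.symm.trans hzq))
  have hjoin : ∀ k u v, F k = s(u, v) → JoinedIn (T k) (D.pos u) (D.pos v) := by
    have hsymm : ∀ (A : Set (ℝ × ℝ)) a b u v, JoinedIn A (D.pos a) (D.pos b) →
        s(a, b) = s(u, v) → JoinedIn A (D.pos u) (D.pos v) := by
      intro A a b u v h hs
      rcases Sym2.eq_iff.1 hs with ⟨rfl, rfl⟩ | ⟨rfl, rfl⟩
      exacts [h, h.symm]
    rintro ⟨p, _ | ⟨i, j⟩⟩ u v huv
    · refine hsymm _ (en (E₁ p) false) (en (E₁ p) true) u v ?_ ((hen _).1.symm.trans huv)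
      rw [← (hen _).2, ← (hen _).2]
      exact (((convex_Icc (0 : ℝ) 1).isPathConnected ⟨0, by simp⟩).image'
        (D.arc_cont (E₁ p))).joinedIn _ ⟨0, by simp⟩ _ ⟨1, by simp⟩
    · refine hsymm _ (en (E₁ p) i) (en (E₂ p) j) u v ?_ huv
      rw [← (hen _).2, ← (hen _).2]
      exact hQj p i j
  refine ⟨F, ⟨D.pos, fun u v => ⋃ k ∈ {k | F k = s(u, v)}, T k, ?_, ?_⟩, ?_, ?_, ?_⟩
  · rintro u v ⟨⟨k, hk⟩, -⟩
    exact (hjoin k u v hk).mono (Set.subset_biUnion_of_mem (u := T) hk)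
  · intro u v x y _ _ hux huy hvx hvy
    simp only [Set.disjoint_iUnion_left, Set.disjoint_iUnion_right]
    intro k hk k' hk'
    refine hdisj _ _ fun w hw hw' => ?_
    have hk : F k = _ := hk
    have hk' : F k' = _ := hk'
    rw [hk', Sym2.mem_iff] at hw
    rw [hk, Sym2.mem_iff] at hw'
    rcases hw with rfl | rfl <;> rcases hw' with rfl | rfl <;> contradiction
  · rintro ⟨p, _ | ⟨i, j⟩⟩
    · exact G.not_isDiag_of_mem_edgeSet (E₁ p).2
    · intro h
      have h : en (E₁ p) i = en (E₂ p) j := h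
      exact hvert p _ (henm _ i) (h ▸ henm _ j)
  · rintro p (_ | ⟨i, j⟩) v hv
    · exact ⟨E₁ p, hE₁ p, hv⟩
    · rcases Sym2.mem_iff.1 hv with rfl | rfl
      exacts [⟨E₁ p, hE₁ p, henm _ _⟩, ⟨E₂ p, hE₂ p, henm _ _⟩]
  · have hnone : ∀ p i j, (E₁ p : Sym2 V) ≠ s(en (E₁ p) i, en (E₂ p) j) := fun p i j h =>
      hvert p (en (E₂ p) j) (by rw [h]; exact Sym2.mem_mk_right _ _) (henm _ _)
    have hcr : ∀ p i j, en (E₁ p) i ≠ en (E₂ p) j := fun p i j h =>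
      hvert p _ (henm _ i) (h ▸ henm _ j)
    have heninj : ∀ e i j, en e i = en e j → i = j := by
      intro e i j h
      by_contra hij
      rw [Bool.eq_not.2 (Ne.symm hij)] at h
      exact henne e i h
    rintro p (_ | ⟨i, j⟩) (_ | ⟨i', j'⟩) h
    · rfl
    · exact (hnone p i' j' h).elim
    · exact (hnone p i j h.symm).elim
    · rcases Sym2.eq_iff.1 h with ⟨h, h'⟩ | ⟨h, -⟩
      · rw [show i = i' from heninj _ _ _ h, show j = j' from heninj _ _ _ h']
      · exact (hcr p i j' h).elim

/-- An NIC-planar drawing on `n` vertices has at most `3 (n - 2) / 5` crossings. -/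
theorem IsNICPlanar.five_mul_crossingCount_le [Fintype V] {D : Drawing G} (hD : D.IsNICPlanar) :
    5 * D.crossingCount ≤ 3 * (Fintype.card V - 2) := by
  classical
  rcases D.crossings.finite_or_infinite with hfin | hinf
  swap
  · simp [crossingCount, hinf.ncard]
  rcases D.crossings.eq_empty_or_nonempty with hemp | hne
  · simp [crossingCount, hemp]
  obtain ⟨F, hF, hdiag, hcl, hinj⟩ := hD.1.exists_kites hfin
  have hFinj : Function.Injective F := by
    rintro ⟨p, x⟩ ⟨q, y⟩ h
    by_cases hpq : p = q
    · subst hpq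
      rw [hinj p x y h]
    · exfalso
      have hle := hD.2 p p.2 q q.2 fun h => hpq (Subtype.ext h)
      rw [Set.ncard_le_one (Set.toFinite _)] at hle
      obtain ⟨u, v, huv⟩ : ∃ u v, F (p, x) = s(u, v) :=
        Sym2.ind (fun u v => ⟨u, v, rfl⟩) (F (p, x))
      have hmem : ∀ w ∈ s(u, v), w ∈ D.cluster p ∩ D.cluster q := fun w hw =>
        ⟨hcl p x w (huv ▸ hw), hcl q y w (h ▸ huv ▸ hw)⟩
      apply hdiag (p, x)
      rw [huv]
      exact hle u (hmem u (Sym2.mem_mk_left _ _)) v (hmem v (Sym2.mem_mk_right _ _))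
  have : Finite D.crossings := hfin
  have : Fintype D.crossings := Fintype.ofFinite _
  have hV : 3 ≤ Fintype.card V := by
    obtain ⟨p⟩ : Nonempty D.crossings := hne.to_subtype
    have h := Fintype.card_le_of_injective (fun x => F (p, x)) fun x y => hinj p x y
    rw [Sym2.card, Fintype.card_option, Fintype.card_prod, Fintype.card_bool] at h
    by_contra! hlt
    have := h.trans (Nat.choose_le_choose 2 (show Fintype.card V + 1 ≤ 3 by omega))
    norm_num [Nat.choose] at this
  have hcard : (Finset.univ.image F).card + 6 ≤ 3 * Fintype.card V := by
    refine (Nat.add_le_add_right (Finset.card_le_card fun e he => ?_) 6).trans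
      (AlmostPlanar.card_edgeFinset_add_six_le (Fintype.card V) hV _ hF Finset.univ rfl
        fun _ _ _ => Finset.mem_univ _)
    obtain ⟨k, -, rfl⟩ := Finset.mem_image.1 he
    refine (@SimpleGraph.mem_edgeFinset _ _ _ (_)).2 ?_
    rw [SimpleGraph.edgeSet_fromEdgeSet]
    exact ⟨⟨k, rfl⟩, hdiag k⟩
  rw [Finset.card_image_of_injective _ hFinj, Finset.card_univ, Fintype.card_prod,
    Fintype.card_option, Fintype.card_prod, Fintype.card_bool] at hcard
  have hcount : D.crossingCount = Fintype.card D.crossings := by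
    rw [crossingCount, ← Nat.card_coe_set_eq, Nat.card_eq_fintype_card]
  omega

end Drawing

/-- every NIC-planar graph `G` with at least two vertices satisfies
`5 · cr(G) ≤ 3 · (v(G) − 2)`. -/
theorem stmt1 {V : Type*} [Fintype V] (G : SimpleGraph V)
    (hG : G.NICPlanar) (hV : 2 ≤ Fintype.card V) :
    5 * G.crossingNumber ≤ 3 * (Fintype.card V - 2) := by
  obtain ⟨D, hD⟩ := hG
  have hle : G.crossingNumber ≤ D.crossingCount := Nat.sInf_le ⟨D, rfl⟩
  exact (Nat.mul_le_mul_left 5 hle).trans hD.five_mul_crossingCount_le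
end
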